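/- Let G be a multigraph whose number of edges is divisible by k. If G is (3k−3)-edge-connected or contains 2k−2 edge-disjoint spanning trees, then G can be edge-decomposed into k spanning subgraphs G_1, …, G_k all having the same number of edges, such that for each vertex v and each i, |d_{G_i}(v) − d_G(v)/k| < 1. -/

import Mathlib

open Finset

variable {V E : Type*}

/-- Degree of `v` in the sub-multigraph given by the edge set `S`,
where `ends e` gives the two endpoints of edge `e` (loops count twice). -/
def mdeg [DecidableEq V] (ends : E → V × V) (S : Finset E) (v : V) : ℕ :=
  (S.filter fun e => (ends e).1 = v).card + (S.filter fun e => (ends e).2 = v).card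

/-- Number of edges with exactly one end in the vertex set `X`. -/
def cutCard [Fintype E] [DecidableEq V] (ends : E → V × V) (X : Finset V) : ℕ :=
  (univ.filter fun e : E =>
    ((ends e).1 ∈ X ∧ (ends e).2 ∉ X) ∨ ((ends e).1 ∉ X ∧ (ends e).2 ∈ X)).card

/-- `lam`-edge-connectedness: every edge cut has at least `lam` edges. -/
def EdgeConn [Fintype V] [Fintype E] [DecidableEq V] (ends : E → V × V) (lam : ℕ) : Prop :=
  ∀ X : Finset V, X.Nonempty → X ≠ univ → lam ≤ cutCard ends X

/-- The edge set `T` is a spanning tree: it connects all vertices and has `|V| - 1` edges. -/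
def IsSpanningTree [Fintype V] [DecidableEq V] (ends : E → V × V) (T : Finset E) : Prop :=
  (∀ a b : V,
    Relation.ReflTransGen (fun u w => ∃ e ∈ T, ends e = (u, w) ∨ ends e = (w, u)) a b) ∧
  T.card + 1 = Fintype.card V

/-- `m`-tree-connectedness: there are `m` pairwise edge-disjoint spanning trees. -/
def TreeConn [Fintype V] [DecidableEq V] (ends : E → V × V) (m : ℕ) : Prop :=
  ∃ Ts : Fin m → Finset E,
    (∀ i j, i ≠ j → Disjoint (Ts i) (Ts j)) ∧ ∀ i, IsSpanningTree ends (Ts i)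

set_option linter.all false

namespace EqFac

/-- Distance of `x` to the nearest multiple of `2 * k`. -/
def nrm (k x : ℤ) : ℤ := min (x % (2 * k)) (2 * k - x % (2 * k))

theorem nrm_le_abs {k : ℤ} (hk : 2 ≤ k) (x j : ℤ) : nrm k x ≤ |x - 2 * k * j| := by
  have h1 := Int.emod_nonneg x (show (2 * k) ≠ 0 by omega)
  have h2 := Int.emod_lt_of_pos x (show 0 < 2 * k by omega)
  have h3 := Int.emod_add_mul_ediv x (2 * k)
  unfold nrm
  set r := x % (2 * k)
  set q := x / (2 * k)
  have h4 : x - 2 * k * j = r + 2 * k * (q - j) := by rw [← h3]; ring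
  rw [h4]
  rcases lt_trichotomy (q - j) 0 with h | h | h
  · have : 2 * k * (q - j) ≤ 2 * k * (-1) := by
      apply mul_le_mul_of_nonneg_left <;> omega
    refine (min_le_right _ _).trans ?_
    rw [abs_of_nonpos (by omega)]
    omega
  · rw [h]; refine (min_le_left _ _).trans ?_
    simpa using le_abs_self r
  · have : 2 * k * 1 ≤ 2 * k * (q - j) := by
      apply mul_le_mul_of_nonneg_left <;> omega
    refine (min_le_left _ _).trans ?_
    rw [abs_of_nonneg (by omega)]
    omega

theorem nrm_exists {k : ℤ} (hk : 2 ≤ k) (x : ℤ) : ∃ j, nrm k x = |x - 2 * k * j| := by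
  have h1 := Int.emod_nonneg x (show (2 * k) ≠ 0 by omega)
  have h2 := Int.emod_lt_of_pos x (show 0 < 2 * k by omega)
  have h3 := Int.emod_add_mul_ediv x (2 * k)
  unfold nrm
  rcases le_total (x % (2 * k)) (2 * k - x % (2 * k)) with h | h
  · refine ⟨x / (2 * k), ?_⟩
    rw [min_eq_left h]
    have : x - 2 * k * (x / (2 * k)) = x % (2 * k) := by linarith
    rw [this, abs_of_nonneg h1]
  · refine ⟨x / (2 * k) + 1, ?_⟩
    rw [min_eq_right h]
    have : x - 2 * k * (x / (2 * k) + 1) = x % (2 * k) - 2 * k := by linarith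
    rw [this, abs_of_nonpos (by omega)]; ring

theorem nrm_nonneg {k : ℤ} (hk : 2 ≤ k) (x : ℤ) : 0 ≤ nrm k x := by
  obtain ⟨j, hj⟩ := nrm_exists hk x
  rw [hj]; positivity

theorem nrm_le {k : ℤ} (hk : 2 ≤ k) (x : ℤ) : nrm k x ≤ k := by
  unfold nrm
  omega

theorem nrm_par {k : ℤ} (hk : 2 ≤ k) (x : ℤ) : 2 ∣ x - nrm k x := by
  obtain ⟨j, hj⟩ := nrm_exists hk x
  rw [hj]
  rcases abs_choice (x - 2 * k * j) with h | h <;> rw [h]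
  · exact ⟨k * j, by ring⟩
  · exact ⟨x - k * j, by ring⟩

theorem nrm_le_of_dvd {k : ℤ} (hk : 2 ≤ k) {x y : ℤ} (h : 2 * k ∣ x - y) : nrm k x ≤ nrm k y := by
  obtain ⟨j, hj⟩ := nrm_exists hk y
  obtain ⟨q, hq⟩ := h
  rw [hj]
  have := nrm_le_abs hk x (j + q)
  have e : x - 2 * k * (j + q) = y - 2 * k * j := by linarith
  rwa [e] at this

theorem nrm_congr {k : ℤ} (hk : 2 ≤ k) {x y : ℤ} (h : 2 * k ∣ x - y) : nrm k x = nrm k y :=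
  le_antisymm (nrm_le_of_dvd hk h) (nrm_le_of_dvd hk (by rw [← neg_sub]; exact (dvd_neg).2 h))

theorem nrm_add_le {k : ℤ} (hk : 2 ≤ k) (x y : ℤ) : nrm k (x + y) ≤ nrm k x + nrm k y := by
  obtain ⟨i, hi⟩ := nrm_exists hk x
  obtain ⟨j, hj⟩ := nrm_exists hk y
  rw [hi, hj]
  have := nrm_le_abs hk (x + y) (i + j)
  refine this.trans ?_
  have e : x + y - 2 * k * (i + j) = (x - 2 * k * i) + (y - 2 * k * j) := by ring
  rw [e]; exact abs_add_le _ _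

theorem nrm_neg {k : ℤ} (hk : 2 ≤ k) (x : ℤ) : nrm k (-x) = nrm k x := by
  apply le_antisymm
  · obtain ⟨j, hj⟩ := nrm_exists hk x
    have := nrm_le_abs hk (-x) (-j)
    have e : -x - 2 * k * (-j) = -(x - 2 * k * j) := by ring
    rw [e, abs_neg] at this
    rw [hj]; exact this
  · obtain ⟨j, hj⟩ := nrm_exists hk (-x)
    have := nrm_le_abs hk (x) (-j)
    have e : x - 2 * k * (-j) = -(-x - 2 * k * j) := by ring
    rw [e, abs_neg] at this
    rw [hj]; exact this

theorem nrm_le_self {k : ℤ} (hk : 2 ≤ k) (x : ℤ) : nrm k x ≤ |x| := by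
  simpa using nrm_le_abs hk x 0

theorem nrm_zero {k : ℤ} (hk : 2 ≤ k) : nrm k 0 = 0 :=
  le_antisymm (by simpa using nrm_le_self hk 0) (nrm_nonneg hk 0)

theorem nrm_add_le' {k : ℤ} (hk : 2 ≤ k) (x y : ℤ) : nrm k (x + y) ≤ nrm k x + |y| :=
  (nrm_add_le hk x y).trans (by have := nrm_le_self hk y; omega)

/-- a decomposition `x = 2 * k * q + r` gives the norm. -/
theorem nrm_of_rep {k : ℤ} (hk : 2 ≤ k) (x r : ℤ) (h : 2 * k ∣ x - r) (h0 : 0 ≤ r)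
    (h1 : r ≤ 2 * k) : nrm k x = min r (2 * k - r) := by
  rw [nrm_congr hk h]
  rcases h1.lt_or_eq with h1 | h1
  · unfold nrm; rw [Int.emod_eq_of_lt h0 h1]
  · subst h1; unfold nrm; simp [min_comm]

/-- indicator -/
def ind {V : Type*} [DecidableEq V] (A : Finset V) (v : V) : ℤ := if v ∈ A then 1 else 0

/-- crossing indicator -/
def cr {V : Type*} [DecidableEq V] (A : Finset V) (p : V × V) : ℤ :=
  if (p.1 ∈ A ↔ p.2 ∈ A) then 0 else 1

/-- cut size -/
def dS {V E : Type*} [DecidableEq V] (ends : E → V × V) (S : Finset E) (A : Finset V) : ℤ :=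
  ∑ e ∈ S, cr A (ends e)

/-- net outflow of `A` -/
def nt {V E : Type*} [DecidableEq V] (ends : E → V × V) (S : Finset E) (ε : E → ℤ)
    (A : Finset V) : ℤ :=
  ∑ e ∈ S, ε e * (ind A (ends e).1 - ind A (ends e).2)

/-- signs -/
def IsSign {E : Type*} (ε : E → ℤ) : Prop := ∀ e, ε e = 1 ∨ ε e = -1

/-- There is an orientation with prescribed net outflow modulo `2 * k`. -/
def Sol {V E : Type*} [DecidableEq V] (k : ℤ) (ends : E → V × V) (S : Finset E) (W : Finset V)
    (c : V → ℤ) : Prop :=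
  ∃ ε : E → ℤ, IsSign ε ∧ ∀ v ∈ W, 2 * k ∣ nt ends S ε {v} - c v

/-- The excess function -/
def F {V E : Type*} [DecidableEq V] (k : ℤ) (ends : E → V × V) (S : Finset E)
    (c o i : V → ℤ) (A : Finset V) : ℤ :=
  dS ends S A + ∑ v ∈ A, (o v + i v) - nrm k (∑ v ∈ A, (c v + o v - i v)) - (2 * k - 2)

section
variable {V E : Type*} [DecidableEq V] [DecidableEq E]

theorem cr_nonneg (A : Finset V) (p : V × V) : 0 ≤ cr A p := by unfold cr; split_ifs <;> simp

theorem cr_eq_abs (A : Finset V) (p : V × V) : cr A p = |ind A p.1 - ind A p.2| := by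
  unfold cr ind; by_cases h1 : p.1 ∈ A <;> by_cases h2 : p.2 ∈ A <;> simp [h1, h2]

theorem dS_nonneg (ends : E → V × V) (S : Finset E) (A : Finset V) : 0 ≤ dS ends S A :=
  Finset.sum_nonneg fun _ _ => cr_nonneg _ _

theorem ind_sum (A : Finset V) (x : V) : ∑ v ∈ A, ind {v} x = ind A x := by
  unfold ind
  simp [Finset.sum_ite_eq]

theorem nt_sum (ends : E → V × V) (S : Finset E) (ε : E → ℤ) (A : Finset V) :
    ∑ v ∈ A, nt ends S ε {v} = nt ends S ε A := by
  unfold nt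
  rw [Finset.sum_comm]
  refine Finset.sum_congr rfl fun e _ => ?_
  rw [← Finset.mul_sum, Finset.sum_sub_distrib, ind_sum, ind_sum]

theorem nt_par (ends : E → V × V) (S : Finset E) (ε : E → ℤ) (hε : IsSign ε) (A : Finset V) :
    2 ∣ dS ends S A - nt ends S ε A := by
  unfold dS nt
  rw [← Finset.sum_sub_distrib]
  refine Finset.dvd_sum fun e _ => ?_
  rw [cr_eq_abs]
  rcases hε e with h | h <;> rw [h] <;>
    rcases abs_choice (ind A (ends e).1 - ind A (ends e).2) with h' | h' <;> rw [h'] <;> omega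

theorem nt_split (ends : E → V × V) (S R : Finset E) (hR : R ⊆ S) (ε : E → ℤ) (A : Finset V) :
    nt ends S ε A = nt ends R ε A + nt ends (S \ R) ε A := by
  unfold nt
  rw [add_comm, Finset.sum_sdiff hR]

theorem dS_split (ends : E → V × V) (S R : Finset E) (hR : R ⊆ S) (A : Finset V) :
    dS ends S A = dS ends R A + dS ends (S \ R) A := by
  unfold dS
  rw [add_comm, Finset.sum_sdiff hR]

theorem nt_congr {ends ends' : E → V × V} {S : Finset E} {ε ε' : E → ℤ} {A A' : Finset V}
    (h : ∀ e ∈ S, ε e * (ind A (ends e).1 - ind A (ends e).2)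
      = ε' e * (ind A' (ends' e).1 - ind A' (ends' e).2)) :
    nt ends S ε A = nt ends' S ε' A' := Finset.sum_congr rfl h

/-- Partial orientation. -/
theorem sol_partial {k : ℤ} {ends : E → V × V} {S R : Finset E} {W : Finset V} {c : V → ℤ}
    (hR : R ⊆ S) (ε0 : E → ℤ) (h0 : IsSign ε0)
    (h : Sol k ends (S \ R) W (fun v => c v - nt ends R ε0 {v})) : Sol k ends S W c := by
  obtain ⟨ε, hε, hs⟩ := h
  refine ⟨fun e => if e ∈ R then ε0 e else ε e, ?_, ?_⟩
  · intro e; by_cases he : e ∈ R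
    · simpa [he] using h0 e
    · simpa [he] using hε e
  · intro v hv
    rw [nt_split ends S R hR]
    have h1 : nt ends R (fun e => if e ∈ R then ε0 e else ε e) {v} = nt ends R ε0 {v} :=
      nt_congr fun e he => by simp [he]
    have h2 : nt ends (S \ R) (fun e => if e ∈ R then ε0 e else ε e) {v}
        = nt ends (S \ R) ε {v} :=
      nt_congr fun e he => by
        have := (Finset.mem_sdiff.1 he).2
        simp [this]
    rw [h1, h2]
    have := hs v hv
    convert this using 1
    ring

/-- The star lemma. -/
theorem star {k : ℤ} (hk : 2 ≤ k) (ends : E → V × V) (R : Finset E) (v : V)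
    (hR : ∀ e ∈ R, cr {v} (ends e) = 1) (c : ℤ) (hpar : 2 ∣ dS ends R {v} - c)
    (hc : nrm k c ≤ dS ends R {v}) :
    ∃ ε : E → ℤ, IsSign ε ∧ 2 * k ∣ nt ends R ε {v} - c := by
  have hD : dS ends R {v} = R.card := by
    unfold dS; rw [Finset.sum_congr rfl hR]; simp
  rw [hD] at hpar hc
  obtain ⟨j, hj⟩ := nrm_exists hk c
  rw [hj] at hc
  obtain ⟨q, hq⟩ := hpar
  set s := c - 2 * k * j with hs
  have hs1 := abs_le.1 hc
  -- number of out edges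
  have hn : ∃ n : ℕ, (2 * n : ℤ) = R.card + s ∧ n ≤ R.card := by
    refine ⟨(R.card - q - k * j).toNat, ?_, ?_⟩
    · rw [Int.toNat_of_nonneg]
      · rw [hs]; linarith
      · have : 2 * (↑R.card - q - k * j) = R.card + s := by rw [hs]; linarith
        omega
    · have : 2 * (↑R.card - q - k * j) = R.card + s := by rw [hs]; linarith
      omega
  obtain ⟨n, hn1, hn2⟩ := hn
  obtain ⟨P, hP, hPc⟩ := Finset.exists_subset_card_eq hn2
  refine ⟨fun e => if (e ∈ P ↔ (ends e).1 = v) then 1 else -1, ?_, ?_⟩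
  · intro e; dsimp only; split_ifs <;> simp
  · have : nt ends R (fun e => if (e ∈ P ↔ (ends e).1 = v) then 1 else -1) {v}
        = ∑ e ∈ R, (if e ∈ P then 1 else -1 : ℤ) := by
      unfold nt
      refine Finset.sum_congr rfl fun e he => ?_
      have := hR e he
      unfold cr at this
      unfold ind
      by_cases h1 : (ends e).1 = v <;> by_cases h2 : (ends e).2 = v <;> by_cases h3 : e ∈ P <;>
        simp [h1, h2, h3] at this ⊢
    rw [this]
    have e2 : ∑ e ∈ R, (if e ∈ P then 1 else -1 : ℤ) = 2 * n - R.card := by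
      have : ∀ e ∈ R, (if e ∈ P then 1 else -1 : ℤ) = 2 * (if e ∈ P then 1 else 0) - 1 := by
        intro e _; split_ifs <;> simp
      rw [Finset.sum_congr rfl this, Finset.sum_sub_distrib, ← Finset.mul_sum, Finset.sum_ite_mem,
        Finset.inter_eq_right.2 hP]
      simp [hPc]
    rw [e2]
    exact ⟨-j, by rw [hn1, hs]; ring⟩

end

section
variable {V E : Type*} [DecidableEq V] [DecidableEq E]

/-- Hypotheses of the rooted orientation theorem. -/
structure Hyp (k : ℤ) (ends : E → V × V) (S : Finset E) (W : Finset V) (c o i : V → ℤ)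
    (U : Finset V) : Prop where
  hk : 2 ≤ k
  mem : ∀ e ∈ S, (ends e).1 ∈ W ∧ (ends e).2 ∈ W
  onn : ∀ v ∈ W, 0 ≤ o v
  inn : ∀ v ∈ W, 0 ≤ i v
  par : ∀ A ⊆ W, 2 ∣ dS ends S A - ∑ v ∈ A, c v
  sum : 2 * k ∣ ∑ v ∈ W, c v
  root : F k ends S c o i W ≤ 0
  Usub : U ⊆ W
  Ucard : U.card ≤ 1
  Uz : ∀ u ∈ U, 2 * k ∣ c u + o u - i u
  cut : ∀ A ⊆ W, A.Nonempty → A ≠ W → A ≠ U → 0 ≤ F k ends S c o i A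

/-- push forward of ends -/
def pE (φ : V → V) (ends : E → V × V) : E → V × V := fun e => (φ (ends e).1, φ (ends e).2)

/-- push forward of a weight -/
def pW (φ : V → V) (W : Finset V) (c : V → ℤ) : V → ℤ := fun w => ∑ v ∈ W.filter (φ · = w), c v

theorem ind_push (φ : V → V) (W B : Finset V) {x : V} (hx : x ∈ W) :
    ind B (φ x) = ind (W.filter (φ · ∈ B)) x := by
  unfold ind
  by_cases h : φ x ∈ B <;> simp [h, hx]

theorem dS_push (φ : V → V) (ends : E → V × V) (S : Finset E) (W B : Finset V)
    (mem : ∀ e ∈ S, (ends e).1 ∈ W ∧ (ends e).2 ∈ W) :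
    dS (pE φ ends) S B = dS ends S (W.filter (φ · ∈ B)) := by
  unfold dS
  refine Finset.sum_congr rfl fun e he => ?_
  have := mem e he
  rw [cr_eq_abs, cr_eq_abs, ← ind_push φ W B this.1, ← ind_push φ W B this.2]
  rfl

theorem nt_push (φ : V → V) (ends : E → V × V) (S : Finset E) (W B : Finset V) (ε : E → ℤ)
    (mem : ∀ e ∈ S, (ends e).1 ∈ W ∧ (ends e).2 ∈ W) :
    nt (pE φ ends) S ε B = nt ends S ε (W.filter (φ · ∈ B)) := by
  unfold nt
  refine Finset.sum_congr rfl fun e he => ?_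
  have := mem e he
  rw [← ind_push φ W B this.1, ← ind_push φ W B this.2]
  rfl

theorem sum_push (φ : V → V) (W B : Finset V) (c : V → ℤ) :
    ∑ w ∈ B, pW φ W c w = ∑ v ∈ W.filter (φ · ∈ B), c v := by
  unfold pW
  simp only [Finset.sum_filter]
  rw [Finset.sum_comm]
  simp

theorem F_push (k : ℤ) (φ : V → V) (ends : E → V × V) (S : Finset E) (W B : Finset V)
    (c o i : V → ℤ) (mem : ∀ e ∈ S, (ends e).1 ∈ W ∧ (ends e).2 ∈ W) :
    F k (pE φ ends) S (pW φ W c) (pW φ W o) (pW φ W i) B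
      = F k ends S c o i (W.filter (φ · ∈ B)) := by
  unfold F
  rw [dS_push φ ends S W B mem]
  simp only [Finset.sum_add_distrib, Finset.sum_sub_distrib, sum_push]

theorem filter_image (φ : V → V) (W : Finset V) : W.filter (φ · ∈ W.image φ) = W := by
  ext v; simp only [Finset.mem_filter, Finset.mem_image]
  exact ⟨fun h => h.1, fun h => ⟨h, v, h, rfl⟩⟩

theorem image_filter (φ : V → V) (W B : Finset V) (hB : B ⊆ W.image φ) :
    (W.filter (φ · ∈ B)).image φ = B := by
  ext w; simp only [Finset.mem_filter, Finset.mem_image]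
  constructor
  · rintro ⟨v, ⟨_, h⟩, rfl⟩; exact h
  · intro h
    obtain ⟨v, hv, rfl⟩ := Finset.mem_image.1 (hB h)
    exact ⟨v, ⟨hv, h⟩, rfl⟩

/-- collapse `A` to `a` -/
def col (A : Finset V) (a : V) : V → V := fun v => if v ∈ A then a else v

theorem col_filter_out {A W : Finset V} {a v : V} (ha : a ∈ A) (hv : v ∈ W) (hvA : v ∉ A) :
    W.filter (col A a · ∈ ({v} : Finset V)) = {v} := by
  ext w
  simp only [Finset.mem_filter, Finset.mem_singleton, col]
  by_cases h : w ∈ A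
  · simp only [h, if_true]
    constructor
    · rintro ⟨_, rfl⟩; exact absurd ha hvA
    · rintro rfl; exact absurd h hvA
  · simp only [h, if_false]
    constructor
    · exact fun h => h.2
    · rintro rfl; exact ⟨hv, rfl⟩

theorem col_filter_in {A W : Finset V} {a : V} (ha : a ∈ A) (hA : A ⊆ W) :
    W.filter (col A a · ∈ ({a} : Finset V)) = A := by
  ext w
  simp only [Finset.mem_filter, Finset.mem_singleton, col]
  by_cases h : w ∈ A
  · simp [h, hA h]
  · simp only [h, if_false, iff_false]
    rintro ⟨_, rfl⟩; exact h ha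

theorem pW_eq (φ : V → V) (W : Finset V) (c : V → ℤ) (w : V) :
    pW φ W c w = ∑ v ∈ W.filter (φ · ∈ ({w} : Finset V)), c v := by
  unfold pW; simp

theorem hyp_collapse {k : ℤ} {ends : E → V × V} {S : Finset E} {W : Finset V} {c o i : V → ℤ}
    {U : Finset V} (H : Hyp k ends S W c o i U) (A : Finset V) (a : V) (ha : a ∈ A) (hA : A ⊆ W)
    (hA2 : 2 ≤ A.card) :
    Hyp k (pE (col A a) ends) S (W.image (col A a)) (pW (col A a) W c) (pW (col A a) W o)
      (pW (col A a) W i) (U \ A) := by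
  have hU : ∀ u ∈ U \ A, ∀ f : V → ℤ, pW (col A a) W f u = f u := by
    intro u hu f
    rw [Finset.mem_sdiff] at hu
    rw [pW_eq, col_filter_out ha (H.Usub hu.1) hu.2, Finset.sum_singleton]
  constructor
  · exact H.hk
  · intro e he
    exact ⟨Finset.mem_image_of_mem _ (H.mem e he).1, Finset.mem_image_of_mem _ (H.mem e he).2⟩
  · intro v hv
    exact Finset.sum_nonneg fun x hx => H.onn x (Finset.mem_filter.1 hx).1
  · intro v hv
    exact Finset.sum_nonneg fun x hx => H.inn x (Finset.mem_filter.1 hx).1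
  · intro B hB
    rw [dS_push _ _ _ W _ H.mem, sum_push]
    exact H.par _ (Finset.filter_subset _ _)
  · rw [sum_push, filter_image]; exact H.sum
  · rw [F_push _ _ _ _ _ _ _ _ _ H.mem, filter_image]; exact H.root
  · intro u hu
    have hu' := Finset.mem_sdiff.1 hu
    exact Finset.mem_image.2 ⟨u, H.Usub hu'.1, by simp [col, hu'.2]⟩
  · exact (Finset.card_le_card Finset.sdiff_subset).trans H.Ucard
  · intro u hu
    rw [hU u hu, hU u hu, hU u hu]
    exact H.Uz u (Finset.mem_sdiff.1 hu).1
  · intro B hB hne hBW hBU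
    rw [F_push _ _ _ _ _ _ _ _ _ H.mem]
    have him := image_filter (col A a) W B hB
    apply H.cut _ (Finset.filter_subset _ _)
    · rw [← Finset.image_nonempty (f := col A a), him]; exact hne
    · intro h; rw [h] at him; exact hBW him.symm
    · intro h
      have hUA : ∀ u ∈ U, u ∉ A := by
        intro u hu huA
        have h1 : A ⊆ U := by
          intro x hx
          rw [← h] at hu ⊢
          rw [Finset.mem_filter] at hu ⊢
          refine ⟨hA hx, ?_⟩
          have := hu.2
          simp only [col, huA, hx, if_true] at this ⊢
          exact this
        have := Finset.card_le_card h1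
        have := H.Ucard
        omega
      apply hBU
      rw [← him, h]
      ext x
      simp only [Finset.mem_image, Finset.mem_sdiff, col]
      constructor
      · rintro ⟨u, hu, rfl⟩
        rw [if_neg (hUA u hu)]; exact ⟨hu, hUA u hu⟩
      · rintro ⟨hx, hxA⟩
        exact ⟨x, hx, if_neg hxA⟩

/-- edges not inside `A` -/
def outE (ends : E → V × V) (S : Finset E) (A : Finset V) : Finset E :=
  S.filter fun e => ¬ ((ends e).1 ∈ A ∧ (ends e).2 ∈ A)

theorem outE_sub (ends : E → V × V) (S : Finset E) (A : Finset V) : outE ends S A ⊆ S :=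
  Finset.filter_subset _ _

theorem mem_inE {ends : E → V × V} {S : Finset E} {A : Finset V} {e : E} 
    (he : e ∈ S \ outE ends S A) : e ∈ S ∧ (ends e).1 ∈ A ∧ (ends e).2 ∈ A := by
  rw [Finset.mem_sdiff, outE, Finset.mem_filter] at he
  refine ⟨he.1, ?_⟩
  by_contra h
  exact he.2 ⟨he.1, h⟩

theorem contract_step {k : ℤ} {ends : E → V × V} {S : Finset E} {W : Finset V} {c : V → ℤ}
    (mem : ∀ e ∈ S, (ends e).1 ∈ W ∧ (ends e).2 ∈ W)
    (A : Finset V) (a : V) (ha : a ∈ A) (hA : A ⊆ W)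
    (h1 : Sol k (pE (col A a) ends) S (W.image (col A a)) (pW (col A a) W c))
    (h2 : ∀ ε, IsSign ε → 2 * k ∣ nt ends (outE ends S A) ε A - ∑ v ∈ A, c v →
      Sol k ends (S \ outE ends S A) A (fun v => c v - nt ends (outE ends S A) ε {v})) :
    Sol k ends S W c := by
  obtain ⟨ε, hε, hs⟩ := h1
  have hout : ∀ v ∈ W, v ∉ A → 2 * k ∣ nt ends S ε {v} - c v := by
    intro v hv hvA
    have := hs v (Finset.mem_image.2 ⟨v, hv, by simp [col, hvA]⟩)
    rwa [nt_push _ _ _ W _ _ mem, pW_eq, col_filter_out ha hv hvA, Finset.sum_singleton] at this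
  have hin : 2 * k ∣ nt ends S ε A - ∑ v ∈ A, c v := by
    have := hs a (Finset.mem_image.2 ⟨a, hA ha, by simp [col]⟩)
    rwa [nt_push _ _ _ W _ _ mem, pW_eq, col_filter_in ha hA] at this
  have hz : ∀ ε', nt ends (S \ outE ends S A) ε' A = 0 := by
    intro ε'
    refine Finset.sum_eq_zero fun e he => ?_
    have := mem_inE he
    simp [ind, this]
  have hz' : ∀ ε', ∀ v ∉ A, nt ends (S \ outE ends S A) ε' {v} = 0 := by
    intro ε' v hv
    refine Finset.sum_eq_zero fun e he => ?_
    have := mem_inE he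
    have a1 : (ends e).1 ≠ v := fun h => hv (h ▸ this.2.1)
    have a2 : (ends e).2 ≠ v := fun h => hv (h ▸ this.2.2)
    simp [ind, a1, a2]
  apply sol_partial (outE_sub ends S A) ε hε
  rw [nt_split ends S _ (outE_sub ends S A), hz, add_zero] at hin
  obtain ⟨ε', hε', hs'⟩ := h2 ε hε hin
  refine ⟨ε', hε', fun v hv => ?_⟩
  by_cases hvA : v ∈ A
  · exact hs' v hvA
  · have := hout v hv hvA
    rw [nt_split ends S _ (outE_sub ends S A), hz' _ _ hvA, add_zero] at this
    rw [hz' _ _ hvA]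
    have e : 0 - (c v - nt ends (outE ends S A) ε {v}) = nt ends (outE ends S A) ε {v} - c v := by
      ring
    rw [e]; exact this

/-- restriction to `A` of the rooted hypotheses -/
theorem hyp_restrict {k : ℤ} (hk : 2 ≤ k) {ends : E → V × V} {S : Finset E} {c o i : V → ℤ}
    {A U : Finset V} (onn : ∀ v ∈ A, 0 ≤ o v) (inn : ∀ v ∈ A, 0 ≤ i v)
    (par : ∀ B ⊆ A, 2 ∣ dS ends S B - ∑ v ∈ B, c v)
    (root : F k ends S c o i A ≤ 0) (Usub : U ⊆ A) (Ucard : U.card ≤ 1)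
    (Uz : ∀ u ∈ U, 2 * k ∣ c u + o u - i u)
    (cut : ∀ B ⊆ A, B.Nonempty → B ≠ A → B ≠ U → 0 ≤ F k ends S c o i B)
    (ε : E → ℤ) (hε : IsSign ε) (hsum : 2 * k ∣ nt ends (outE ends S A) ε A - ∑ v ∈ A, c v) :
    ∃ o' i', Hyp k ends (S \ outE ends S A) A (fun v => c v - nt ends (outE ends S A) ε {v})
      o' i' U := by
  set R := outE ends S A with hR
  have hRS : R ⊆ S := outE_sub ends S A
  let x : V → E → ℤ := fun v e => ε e * (ind {v} (ends e).1 - ind {v} (ends e).2)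
  have hx : ∀ v e, |x v e| = cr {v} (ends e) := by
    intro v e
    rw [cr_eq_abs, abs_mul]
    rcases hε e with h | h <;> simp [h]
  set o' : V → ℤ := fun v => o v + ∑ e ∈ R, max (x v e) 0 with ho'
  set i' : V → ℤ := fun v => i v + ∑ e ∈ R, max (- x v e) 0 with hi'
  have hd : ∀ v, c v - nt ends R ε {v} + o' v - i' v = c v + o v - i v := by
    intro v
    have : nt ends R ε {v} = ∑ e ∈ R, max (x v e) 0 - ∑ e ∈ R, max (- x v e) 0 := by
      rw [← Finset.sum_sub_distrib]
      refine Finset.sum_congr rfl fun e _ => ?_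
      change x v e = _
      omega
    simp only [ho', hi']
    rw [this]; ring
  have hp : ∀ v, o' v + i' v = o v + i v + dS ends R {v} := by
    intro v
    have : dS ends R {v} = ∑ e ∈ R, max (x v e) 0 + ∑ e ∈ R, max (- x v e) 0 := by
      rw [← Finset.sum_add_distrib]
      refine Finset.sum_congr rfl fun e _ => ?_
      rw [← hx]
      rcases abs_cases (x v e) with h | h <;> omega
    simp only [ho', hi']
    rw [this]; ring
  have hdR : ∀ B ⊆ A, dS ends R B = ∑ v ∈ B, dS ends R {v} := by
    intro B hB
    unfold dS
    rw [Finset.sum_comm]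
    refine Finset.sum_congr rfl fun e he => ?_
    have he2 := (Finset.mem_filter.1 he).2
    have : ∀ v ∈ B, cr {v} (ends e) = ind {v} (ends e).1 + ind {v} (ends e).2 := by
      intro v hv
      have hvA := hB hv
      unfold cr ind
      by_cases h1 : (ends e).1 = v <;> by_cases h2 : (ends e).2 = v <;> simp [h1, h2]
      rw [h1, h2] at he2
      exact he2 ⟨hvA, hvA⟩
    rw [Finset.sum_congr rfl this, Finset.sum_add_distrib, ind_sum, ind_sum]
    unfold cr ind
    by_cases h1 : (ends e).1 ∈ B <;> by_cases h2 : (ends e).2 ∈ B <;> simp [h1, h2]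
    exact he2 ⟨hB h1, hB h2⟩
  have hF : ∀ B ⊆ A, F k ends (S \ R) (fun v => c v - nt ends R ε {v}) o' i' B
      = F k ends S c o i B := by
    intro B hB
    unfold F
    rw [Finset.sum_congr rfl (fun v _ => hp v), Finset.sum_congr rfl (fun v _ => hd v),
      dS_split ends S R hRS, Finset.sum_add_distrib, ← hdR B hB]
    ring
  refine ⟨o', i', ?_⟩
  constructor
  · exact hk
  · intro e he; exact (mem_inE he).2
  · intro v hv
    have := onn v hv
    have : 0 ≤ ∑ e ∈ R, max (x v e) 0 := Finset.sum_nonneg fun _ _ => le_max_right _ _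
    simp only [ho']; omega
  · intro v hv
    have := inn v hv
    have : 0 ≤ ∑ e ∈ R, max (- x v e) 0 := Finset.sum_nonneg fun _ _ => le_max_right _ _
    simp only [hi']; omega
  · intro B hB
    have h1 := par B hB
    have h2 := nt_par ends R ε hε B
    rw [dS_split ends S R hRS] at h1
    rw [Finset.sum_sub_distrib, nt_sum]
    omega
  · rw [Finset.sum_sub_distrib, nt_sum]
    rw [← dvd_neg, neg_sub]; exact hsum
  · rw [hF A (Finset.Subset.refl _)]; exact root
  · exact Usub
  · exact Ucard
  · intro u hu
    rw [hd]; exact Uz u hu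
  · intro B hB h1 h2 h3
    rw [hF B hB]; exact cut B hB h1 h2 h3

theorem two_sol {k : ℤ} (hk : 2 ≤ k) {ends : E → V × V} {S : Finset E} {c : V → ℤ} {u y : V}
    (huy : u ≠ y) (mem : ∀ e ∈ S, (ends e).1 ∈ ({u, y} : Finset V) ∧ (ends e).2 ∈ ({u, y} : Finset V))
    (hsum : 2 * k ∣ c u + c y) (hpar : 2 ∣ dS ends S {u} - c u) (hc : nrm k (c u) ≤ dS ends S {u}) :
    Sol k ends S {u, y} c := by
  set R := S.filter fun e => cr {u} (ends e) = 1 with hR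
  have hRS : R ⊆ S := Finset.filter_subset _ _
  have h0 : ∀ e ∈ S \ R, cr {u} (ends e) = 0 := by
    intro e he
    rw [Finset.mem_sdiff, hR, Finset.mem_filter] at he
    unfold cr at he ⊢
    split_ifs with h
    · rfl
    · rw [if_neg h] at he
      exact absurd ⟨he.1, rfl⟩ he.2
  have hd : dS ends R {u} = dS ends S {u} := by
    rw [dS_split ends S R hRS]
    have : dS ends (S \ R) {u} = 0 := Finset.sum_eq_zero h0
    omega
  obtain ⟨ε, hε, h⟩ := star hk ends R u (fun e he => (Finset.mem_filter.1 he).2) (c u)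
    (by rw [hd]; exact hpar) (by rw [hd]; exact hc)
  have h1 : nt ends S ε {u} = nt ends R ε {u} := by
    rw [nt_split ends S R hRS]
    have : nt ends (S \ R) ε {u} = 0 := Finset.sum_eq_zero fun e he => by
      have := h0 e he
      rw [cr_eq_abs, abs_eq_zero] at this
      rw [this, mul_zero]
    omega
  have h2 : nt ends S ε {u} + nt ends S ε {y} = 0 := by
    have := nt_sum ends S ε {u, y}
    rw [Finset.sum_pair huy] at this
    rw [this]
    refine Finset.sum_eq_zero fun e he => ?_
    have := mem e he
    unfold ind
    rw [if_pos this.1, if_pos this.2]; ring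
  refine ⟨ε, hε, fun v hv => ?_⟩
  rw [Finset.mem_insert, Finset.mem_singleton] at hv
  rcases hv with rfl | rfl
  · rw [h1]; exact h
  · rw [← h1] at h
    have := (h.add hsum).neg_right
    have e : -(nt ends S ε {u} - c u + (c u + c v)) = -nt ends S ε {u} - c v := by ring
    rw [e] at this
    have e2 : nt ends S ε {v} = - nt ends S ε {u} := by omega
    rw [e2]; exact this

theorem pend {k : ℤ} (hk : 2 ≤ k) {ends : E → V × V} {S : Finset E} {W : Finset V} {c : V → ℤ}
    (mem : ∀ e ∈ S, (ends e).1 ∈ W ∧ (ends e).2 ∈ W) {u y : V} (huy : u ≠ y)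
    (hu : u ∈ W) (hy : y ∈ W) (hN : ∀ e ∈ S, cr {u} (ends e) = 1 → cr {u, y} (ends e) = 0)
    (hpar : 2 ∣ dS ends S {u} - c u) (hc : nrm k (c u) ≤ dS ends S {u})
    (h1 : Sol k (pE (col {u, y} y) ends) S (W.image (col {u, y} y)) (pW (col {u, y} y) W c)) :
    Sol k ends S W c := by
  refine contract_step mem {u, y} y (by simp) ?_ h1 ?_
  · intro x hx
    rw [Finset.mem_insert, Finset.mem_singleton] at hx
    rcases hx with rfl | rfl <;> assumption
  intro ε hε hsum
  set R := outE ends S {u, y} with hR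
  have hRS : R ⊆ S := outE_sub ends S _
  have h0 : ∀ e ∈ R, ind {u} (ends e).1 - ind {u} (ends e).2 = 0 := by
    intro e he
    have h1 := hN e (hRS he)
    have h2 := (Finset.mem_filter.1 he).2
    unfold cr at h1
    unfold ind
    by_cases a1 : (ends e).1 = u <;> by_cases a2 : (ends e).2 = u <;> simp_all
  have hn : nt ends R ε {u} = 0 := Finset.sum_eq_zero fun e he => by rw [h0 e he, mul_zero]
  have hd : dS ends S {u} = dS ends (S \ R) {u} := by
    rw [dS_split ends S R hRS]
    have : dS ends R {u} = 0 := Finset.sum_eq_zero fun e he => by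
      rw [cr_eq_abs, h0 e he, abs_zero]
    omega
  apply two_sol hk huy
  · intro e he; exact (mem_inE he).2
  · rw [← nt_sum, Finset.sum_pair huy, Finset.sum_pair huy] at hsum
    rw [← dvd_neg]
    have e : -(c u - nt ends R ε {u} + (c y - nt ends R ε {y}))
      = nt ends R ε {u} + nt ends R ε {y} - (c u + c y) := by ring
    rw [e]; exact hsum
  · rw [hn, ← hd, sub_zero]; exact hpar
  · rw [hn, ← hd, sub_zero]; exact hc

end

section
variable {V E : Type*} [DecidableEq V] [DecidableEq E]

theorem cr_swap (A : Finset V) (x y : V) : cr A (x, y) = cr A (y, x) := by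
  unfold cr; simp [iff_comm]

theorem cr_le_one (A : Finset V) (p : V × V) : cr A p ≤ 1 := by unfold cr; split_ifs <;> simp

/-- the ends of an edge as an unordered pair -/
def Joins (p : V × V) (x y : V) : Prop := p = (x, y) ∨ p = (y, x)

theorem Joins.cr_eq {p : V × V} {x y : V} (h : Joins p x y) (A : Finset V) :
    cr A p = cr A (x, y) := by
  rcases h with rfl | rfl
  · rfl
  · exact cr_swap _ _ _

theorem Joins.symm {p : V × V} {x y : V} (h : Joins p x y) : Joins p y x := Or.symm h

theorem Joins.sign {p : V × V} {x y : V} (h : Joins p x y) :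
    ∃ σ : ℤ, (σ = 1 ∨ σ = -1) ∧ ∀ A : Finset V,
      σ * (ind A p.1 - ind A p.2) = ind A x - ind A y := by
  rcases h with rfl | rfl
  · exact ⟨1, Or.inl rfl, fun A => by ring⟩
  · exact ⟨-1, Or.inr rfl, fun A => by ring⟩

theorem joins_of_cr {p : V × V} {u : V} (h : cr {u} p = 1) : ∃ y, y ≠ u ∧ Joins p u y := by
  obtain ⟨a, b⟩ := p
  unfold cr at h
  by_cases h1 : a = u <;> by_cases h2 : b = u <;> simp [h1, h2] at h
  · exact ⟨b, h2, Or.inl (by rw [h1])⟩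
  · exact ⟨a, h1, Or.inr (by rw [h2])⟩

theorem cr_cases (A : Finset V) (p : V × V) : cr A p = 0 ∨ cr A p = 1 := by
  unfold cr; split_ifs <;> simp

theorem ind_cases (A : Finset V) (p : V) : ind A p = 0 ∨ ind A p = 1 := by
  unfold ind; split_ifs <;> simp

theorem cr_xy (A : Finset V) (x y : V) : cr A (x, y) = |ind A x - ind A y| := cr_eq_abs _ _

theorem dS_W {ends : E → V × V} {S : Finset E} {W : Finset V}
    (mem : ∀ e ∈ S, (ends e).1 ∈ W ∧ (ends e).2 ∈ W) : dS ends S W = 0 :=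
  Finset.sum_eq_zero fun e he => by simp [cr, mem e he]

theorem dS_compl {ends : E → V × V} {S : Finset E} {W : Finset V}
    (mem : ∀ e ∈ S, (ends e).1 ∈ W ∧ (ends e).2 ∈ W) (A : Finset V) :
    dS ends S (W \ A) = dS ends S A :=
  Finset.sum_congr rfl fun e he => by simp [cr, mem e he, not_iff_not]

theorem Hyp.F_even {k : ℤ} {ends : E → V × V} {S : Finset E} {W : Finset V} {c o i : V → ℤ}
    {U : Finset V} (H : Hyp k ends S W c o i U) {A : Finset V} (hA : A ⊆ W) :
    2 ∣ F k ends S c o i A := by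
  have h1 := H.par A hA
  have h2 := nrm_par H.hk (∑ v ∈ A, (c v + o v - i v))
  unfold F
  generalize nrm k (∑ v ∈ A, (c v + o v - i v)) = N at *
  simp only [Finset.sum_add_distrib, Finset.sum_sub_distrib] at *
  omega

theorem Hyp.cut_big {k : ℤ} {ends : E → V × V} {S : Finset E} {W : Finset V} {c o i : V → ℤ}
    {U : Finset V} (H : Hyp k ends S W c o i U) {A : Finset V} (hA : A ⊆ W)
    (h1 : 0 ≤ F k ends S c o i A) (h2 : 0 ≤ F k ends S c o i (W \ A)) :
    k - 1 ≤ dS ends S A := by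
  have h3 := H.root
  unfold F at h1 h2 h3
  rw [dS_W H.mem] at h3
  rw [dS_compl H.mem] at h2
  have e1 := Finset.sum_sdiff (f := fun v => o v + i v) hA
  have e2 := Finset.sum_sdiff (f := fun v => c v + o v - i v) hA
  rw [← e1, ← e2] at h3
  have := nrm_add_le H.hk (∑ v ∈ W \ A, (c v + o v - i v)) (∑ v ∈ A, (c v + o v - i v))
  omega

theorem Hyp.single {k : ℤ} {ends : E → V × V} {S : Finset E} {W : Finset V} {c o i : V → ℤ}
    {U : Finset V} (H : Hyp k ends S W c o i U) {u : V} (hu : u ∈ W)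
    (hne : (W \ {u}).Nonempty) (hU : W \ {u} ≠ U) : nrm k (c u) ≤ dS ends S {u} := by
  have hs : ({u} : Finset V) ⊆ W := Finset.singleton_subset_iff.2 hu
  have hWu : W \ {u} ≠ W := by
    intro h; rw [← h] at hu; simp at hu
  have h2 := H.cut (W \ {u}) Finset.sdiff_subset hne hWu hU
  by_cases huU : {u} = U
  · have hz := H.Uz u (by rw [← huU]; simp)
    have h3 := H.root
    unfold F at h2 h3
    rw [dS_W H.mem] at h3
    rw [dS_compl H.mem] at h2
    have e1 := Finset.sum_sdiff (f := fun v => o v + i v) hs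
    have e2 := Finset.sum_sdiff (f := fun v => c v + o v - i v) hs
    rw [← e1, ← e2] at h3
    rw [Finset.sum_singleton, Finset.sum_singleton] at h3
    have e3 : nrm k (∑ x ∈ W \ {u}, (c x + o x - i x) + (c u + o u - i u))
      = nrm k (∑ x ∈ W \ {u}, (c x + o x - i x)) := nrm_congr H.hk (by simpa using hz)
    have e4 : nrm k (c u) = nrm k (i u - o u) := nrm_congr H.hk (by
      have e : c u - (i u - o u) = c u + o u - i u := by ring
      rw [e]; exact hz)
    have e5 := nrm_le_self H.hk (i u - o u)
    have a1 := H.onn u hu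
    have a2 := H.inn u hu
    have : |i u - o u| ≤ i u + o u := abs_le.2 ⟨by omega, by omega⟩
    omega
  · have h1 := H.cut {u} hs (by simp) (fun h => by rw [← h] at hne; simp at hne) huU
    have := H.cut_big hs h1 h2
    have p1 := H.par {u} hs
    rw [Finset.sum_singleton] at p1
    have p2 := nrm_par H.hk (c u)
    have p3 := nrm_le H.hk (c u)
    omega

theorem F_neg {k : ℤ} (hk : 2 ≤ k) (ends : E → V × V) (S : Finset E) (c o i : V → ℤ)
    (A : Finset V) : F k ends S (fun v => - c v) i o A = F k ends S c o i A := by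
  unfold F
  have e1 : ∑ v ∈ A, (- c v + i v - o v) = - ∑ v ∈ A, (c v + o v - i v) := by
    rw [← Finset.sum_neg_distrib]; exact Finset.sum_congr rfl fun v _ => by ring
  have e2 : ∑ v ∈ A, (i v + o v) = ∑ v ∈ A, (o v + i v) :=
    Finset.sum_congr rfl fun v _ => by ring
  rw [e1, e2, nrm_neg hk]

theorem Hyp.neg {k : ℤ} {ends : E → V × V} {S : Finset E} {W : Finset V} {c o i : V → ℤ}
    {U : Finset V} (H : Hyp k ends S W c o i U) :
    Hyp k ends S W (fun v => - c v) i o U where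
  hk := H.hk
  mem := H.mem
  onn := H.inn
  inn := H.onn
  par := fun A hA => by
    have := H.par A hA
    rw [Finset.sum_neg_distrib]; omega
  sum := by rw [Finset.sum_neg_distrib, dvd_neg]; exact H.sum
  root := by rw [F_neg H.hk]; exact H.root
  Usub := H.Usub
  Ucard := H.Ucard
  Uz := fun u hu => by
    have := (H.Uz u hu).neg_right
    have e : -(c u + o u - i u) = - c u + i u - o u := by ring
    rwa [e] at this
  cut := fun A h1 h2 h3 h4 => by rw [F_neg H.hk]; exact H.cut A h1 h2 h3 h4

theorem Sol.neg {k : ℤ} {ends : E → V × V} {S : Finset E} {W : Finset V} {c : V → ℤ}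
    (h : Sol k ends S W (fun v => - c v)) : Sol k ends S W c := by
  obtain ⟨ε, hε, hs⟩ := h
  refine ⟨fun e => - ε e, fun e => ?_, fun v hv => ?_⟩
  · rcases hε e with h | h <;> simp [h]
  · have := (hs v hv).neg_right
    have e : nt ends S (fun e => - ε e) {v} = - nt ends S ε {v} := by
      unfold nt; rw [← Finset.sum_neg_distrib]
      exact Finset.sum_congr rfl fun e _ => by ring
    rw [e]
    have e2 : -(nt ends S ε {v} - - c v) = - nt ends S ε {v} - c v := by ring
    rwa [e2] at this

/-- Lifting two edges at `u`. -/
theorem lift_sol {k : ℤ} {ends : E → V × V} {S : Finset E} {W : Finset V} {c : V → ℤ}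
    {e1 e2 : E} {u y1 y2 : V} (he : e1 ≠ e2) (h1 : e1 ∈ S) (h2 : e2 ∈ S)
    (j1 : Joins (ends e1) y1 u) (j2 : Joins (ends e2) u y2)
    (h : Sol k (Function.update ends e1 (y1, y2)) (S.erase e2) W c) : Sol k ends S W c := by
  obtain ⟨ε, hε, hs⟩ := h
  obtain ⟨σ1, hσ1, hj1⟩ := j1.sign
  obtain ⟨σ2, hσ2, hj2⟩ := j2.sign
  refine ⟨fun e => if e = e1 then ε e1 * σ1 else if e = e2 then ε e1 * σ2 else ε e, ?_, ?_⟩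
  · intro e
    dsimp only
    split_ifs
    · rcases hε e1 with h | h <;> rcases hσ1 with h' | h' <;> simp [h, h']
    · rcases hε e1 with h | h <;> rcases hσ2 with h' | h' <;> simp [h, h']
    · exact hε e
  · intro v hv
    have key : nt ends S (fun e => if e = e1 then ε e1 * σ1 else if e = e2 then ε e1 * σ2 else ε e)
        {v} = nt (Function.update ends e1 (y1, y2)) (S.erase e2) ε {v} := by
      have m1 : e1 ∈ S.erase e2 := Finset.mem_erase.2 ⟨he, h1⟩
      unfold nt
      rw [← Finset.add_sum_erase S _ h2, ← Finset.add_sum_erase (S.erase e2) _ m1,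
        ← Finset.add_sum_erase (S.erase e2) _ m1]
      have : ∀ e ∈ (S.erase e2).erase e1,
          (if e = e1 then ε e1 * σ1 else if e = e2 then ε e1 * σ2 else ε e)
            * (ind {v} (ends e).1 - ind {v} (ends e).2)
          = ε e * (ind {v} (Function.update ends e1 (y1, y2) e).1
              - ind {v} (Function.update ends e1 (y1, y2) e).2) := by
        intro e he
        rw [Finset.mem_erase, Finset.mem_erase] at he
        rw [if_neg he.1, if_neg he.2.1, Function.update_of_ne he.1]
      rw [Finset.sum_congr rfl this]
      simp only [if_true, if_neg he.symm, Function.update_self]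
      rw [mul_assoc, mul_assoc, hj1, hj2]
      ring
    rw [key]; exact hs v hv

theorem dS_lift {ends : E → V × V} {S : Finset E}
    {e1 e2 : E} {u y1 y2 : V} (he : e1 ≠ e2) (h1 : e1 ∈ S) (h2 : e2 ∈ S)
    (j1 : Joins (ends e1) y1 u) (j2 : Joins (ends e2) u y2) (A : Finset V) :
    dS (Function.update ends e1 (y1, y2)) (S.erase e2) A
      = dS ends S A - cr A (y1, u) - cr A (u, y2) + cr A (y1, y2) := by
  have m1 : e1 ∈ S.erase e2 := Finset.mem_erase.2 ⟨he, h1⟩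
  unfold dS
  rw [← Finset.add_sum_erase S _ h2, ← Finset.add_sum_erase (S.erase e2) _ m1,
    ← Finset.add_sum_erase (S.erase e2) _ m1]
  have : ∀ e ∈ (S.erase e2).erase e1, cr A (Function.update ends e1 (y1, y2) e) = cr A (ends e) := by
    intro e he
    rw [Finset.mem_erase] at he
    rw [Function.update_of_ne he.1]
  rw [Finset.sum_congr rfl this, j1.cr_eq, j2.cr_eq, Function.update_self]
  ring

theorem cr_tri (A : Finset V) (x y z : V) :
    2 ∣ cr A (x, y) + cr A (y, z) - cr A (x, z) ∧ cr A (x, z) ≤ cr A (x, y) + cr A (y, z) ∧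
    cr A (x, y) + cr A (y, z) ≤ cr A (x, z) + 2 := by
  unfold cr
  by_cases h1 : x ∈ A <;> by_cases h2 : y ∈ A <;> by_cases h3 : z ∈ A <;> simp [h1, h2, h3]

theorem cr_single (u y1 y2 v : V) (hv : v ≠ u) (h12 : y1 ≠ y2) :
    cr {v} (y1, u) + cr {v} (u, y2) = cr {v} (y1, y2) := by
  unfold cr
  by_cases h1 : y1 = v <;> by_cases h3 : y2 = v <;> simp_all [eq_comm]

theorem mem_lift {ends : E → V × V} {S : Finset E} {W : Finset V} {e1 e2 : E} {y1 y2 : V}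
    (mem : ∀ e ∈ S, (ends e).1 ∈ W ∧ (ends e).2 ∈ W) (h1 : y1 ∈ W) (h2 : y2 ∈ W) :
    ∀ e ∈ S.erase e2, (Function.update ends e1 (y1, y2) e).1 ∈ W ∧
      (Function.update ends e1 (y1, y2) e).2 ∈ W := by
  intro e he
  by_cases h : e = e1
  · subst h; rw [Function.update_self]; exact ⟨h1, h2⟩
  · rw [Function.update_of_ne h]; exact mem e (Finset.mem_of_mem_erase he)

theorem Joins.mem {ends : E → V × V} {S : Finset E} {W : Finset V} {e : E} {x y : V}
    (mem : ∀ e ∈ S, (ends e).1 ∈ W ∧ (ends e).2 ∈ W) (he : e ∈ S) (h : Joins (ends e) x y) :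
    x ∈ W ∧ y ∈ W := by
  have := mem e he
  rcases h with h | h <;> rw [h] at this
  · exact this
  · exact this.symm

theorem Hyp.lift {k : ℤ} {ends : E → V × V} {S : Finset E} {W : Finset V} {c o i : V → ℤ}
    {e1 e2 : E} {u y1 y2 : V}
    (H : Hyp k ends S W c o i {u})
    (hT : ∀ A ⊆ W, A ≠ W → 2 ≤ A.card → 2 ≤ F k ends S c o i A)
    (he : e1 ≠ e2) (h1 : e1 ∈ S) (h2 : e2 ∈ S) (h12 : y1 ≠ y2)
    (j1 : Joins (ends e1) y1 u) (j2 : Joins (ends e2) u y2) :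
    Hyp k (Function.update ends e1 (y1, y2)) (S.erase e2) W c o i {u} := by
  have hm := mem_lift (e1 := e1) (e2 := e2) H.mem (j1.mem H.mem h1).1 (j2.mem H.mem h2).2
  have hd := dS_lift he h1 h2 j1 j2
  refine { H with mem := hm, par := ?_, root := ?_, cut := ?_ }
  · intro A hA
    have := H.par A hA
    have := cr_tri A y1 u y2
    rw [hd]; omega
  · have := H.root
    unfold F at this ⊢
    rw [dS_W H.mem] at this
    rw [dS_W hm]; exact this
  · intro A hA hne hW hU
    have hF := H.cut A hA hne hW hU
    have ht := cr_tri A y1 u y2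
    rcases Nat.lt_or_ge A.card 2 with hc | hc
    · have : A.card = 1 := by have := hne.card_pos; omega
      obtain ⟨v, rfl⟩ := Finset.card_eq_one.1 this
      have hv : v ≠ u := fun h => hU (by rw [h])
      have := cr_single u y1 y2 v hv h12
      unfold F at hF ⊢
      rw [hd]; omega
    · have := hT A hA hW hc
      unfold F at this ⊢
      rw [hd]; omega

/-- delete an edge, orienting it from `x` to `y`. -/
theorem del_sol {k : ℤ} {ends : E → V × V} {S : Finset E} {W : Finset V} {c : V → ℤ}
    {e : E} {x y : V} (he : e ∈ S) (j : Joins (ends e) x y)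
    (h : Sol k ends (S.erase e) W (fun v => c v - ind {v} x + ind {v} y)) : Sol k ends S W c := by
  obtain ⟨σ, hσ, hj⟩ := j.sign
  apply sol_partial (R := {e}) (Finset.singleton_subset_iff.2 he) (fun _ => σ) (fun _ => hσ)
  rw [Finset.sdiff_singleton_eq_erase]
  have : (fun v => c v - nt ends {e} (fun _ => σ) {v}) = fun v => c v - ind {v} x + ind {v} y := by
    funext v
    unfold nt
    rw [Finset.sum_singleton, hj]; ring
  rw [this]; exact h

theorem Hyp.del {k : ℤ} {ends : E → V × V} {S : Finset E} {W : Finset V} {c o i : V → ℤ}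
    {e : E} {x y : V} (H : Hyp k ends S W c o i ∅)
    (hT : ∀ A ⊆ W, A ≠ W → 2 ≤ A.card → 2 ≤ F k ends S c o i A)
    (he : e ∈ S) (hxy : x ≠ y) (j : Joins (ends e) x y) (r : ℤ) (hr : 0 ≤ r)
    (hx : nrm k (c x + o x - i x - 1) = nrm k (c x + o x - i x) - 1)
    (hy : nrm k (c y + o y - i y + 1 + r) = nrm k (c y + o y - i y) - 1 + r)
    (hW : ∑ v ∈ W, (o v + i v) + r - nrm k (∑ v ∈ W, (c v + o v - i v) + r) ≤ 2 * k - 2) :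
    Hyp k ends (S.erase e) W (fun v => c v - ind {v} x + ind {v} y)
      (fun v => o v + r * ind {v} y) i ∅ := by
  obtain ⟨hxW, hyW⟩ := j.mem H.mem he
  have hm : ∀ e' ∈ S.erase e, (ends e').1 ∈ W ∧ (ends e').2 ∈ W :=
    fun e' he' => H.mem e' (Finset.mem_of_mem_erase he')
  have hd : ∀ A, dS ends (S.erase e) A = dS ends S A - cr A (x, y) := by
    intro A
    unfold dS
    rw [← Finset.add_sum_erase S _ he, j.cr_eq]; ring
  have hc : ∀ A, ∑ v ∈ A, (c v - ind {v} x + ind {v} y) = ∑ v ∈ A, c v - ind A x + ind A y := by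
    intro A
    rw [Finset.sum_add_distrib, Finset.sum_sub_distrib, ind_sum, ind_sum]
  have hF : ∀ A, F k ends (S.erase e) (fun v => c v - ind {v} x + ind {v} y)
      (fun v => o v + r * ind {v} y) i A = dS ends S A - cr A (x, y) + ∑ v ∈ A, (o v + i v)
      + r * ind A y - nrm k (∑ v ∈ A, (c v + o v - i v) + (ind A y - ind A x + r * ind A y))
        - (2 * k - 2) := by
    intro A
    unfold F
    rw [hd]
    have a1 : ∑ v ∈ A, (o v + r * ind {v} y + i v) = ∑ v ∈ A, (o v + i v) + r * ind A y := by
      rw [← ind_sum, Finset.mul_sum, ← Finset.sum_add_distrib]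
      exact Finset.sum_congr rfl fun v _ => by ring
    have a2 : ∑ v ∈ A, (c v - ind {v} x + ind {v} y + (o v + r * ind {v} y) - i v)
        = ∑ v ∈ A, (c v + o v - i v) + (ind A y - ind A x + r * ind A y) := by
      rw [← ind_sum A x, ← ind_sum A y, Finset.mul_sum, ← Finset.sum_sub_distrib,
        ← Finset.sum_add_distrib, ← Finset.sum_add_distrib]
      exact Finset.sum_congr rfl fun v _ => by ring
    rw [a1, a2]; ring
  refine { hk := H.hk, mem := hm, onn := ?_, inn := H.inn, par := ?_, sum := ?_, root := ?_, 
           Usub := by simp, Ucard := by simp, Uz := by simp, cut := ?_ }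
  · intro v hv
    have := H.onn v hv
    have : 0 ≤ r * ind {v} y := by
      rcases ind_cases {v} y with h | h <;> rw [h] <;> omega
    omega
  · intro A hA
    have := H.par A hA
    rw [hd, hc, cr_xy]
    rcases abs_cases (ind A x - ind A y) with h | h <;> omega
  · rw [hc]; simpa [ind, hxW, hyW] using H.sum
  · rw [hF, dS_W H.mem]
    have a1 : ind W x = 1 := by simp [ind, hxW]
    have a2 : ind W y = 1 := by simp [ind, hyW]
    rw [cr_xy, a1, a2]
    simp only [sub_self, abs_zero, mul_one, zero_add]
    omega
  · intro A hA hne hAW _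
    have h0 := H.cut A hA hne hAW (fun h => by rw [h] at hne; simp at hne)
    rcases Nat.lt_or_ge A.card 2 with hc | hc
    · have : A.card = 1 := by have := hne.card_pos; omega
      obtain ⟨v, rfl⟩ := Finset.card_eq_one.1 this
      rw [hF]
      unfold F at h0
      rw [Finset.sum_singleton, Finset.sum_singleton] at h0 ⊢
      by_cases hvx : v = x
      · subst hvx
        have a1 : ind {v} v = 1 := by simp [ind]
        have a2 : ind {v} y = 0 := by simp [ind, hxy.symm]
        rw [cr_xy, a1, a2]
        have e : c v + o v - i v + (0 - 1 + r * 0) = c v + o v - i v - 1 := by ring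
        rw [e, hx]
        simp only [sub_zero, abs_one, mul_zero]; omega
      · by_cases hvy : v = y
        · subst hvy
          have a1 : ind {v} v = 1 := by simp [ind]
          have a2 : ind {v} x = 0 := by simp [ind, hxy]
          rw [cr_xy, a1, a2]
          have e : c v + o v - i v + (1 - 0 + r * 1) = c v + o v - i v + 1 + r := by ring
          rw [e, hy]
          simp only [zero_sub, abs_neg, abs_one, mul_one]; omega
        · have a1 : ind {v} x = 0 := by simp [ind, Ne.symm hvx]
          have a2 : ind {v} y = 0 := by simp [ind, Ne.symm hvy]
          rw [cr_xy, a1, a2]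
          simp only [sub_self, abs_zero, mul_zero, add_zero, sub_zero]
          exact h0
    · have h2 := hT A hA hAW hc
      rw [hF, cr_xy]
      unfold F at h2
      have := nrm_add_le' H.hk (∑ v ∈ A, (c v + o v - i v)) (ind A y - ind A x + r * ind A y)
      generalize ∑ v ∈ A, (c v + o v - i v) = hA' at *
      rcases ind_cases A x with h | h <;> rcases ind_cases A y with h' | h' <;>
        rw [h, h'] at this ⊢ <;> norm_num at this ⊢ 
      · omega
      · rw [abs_of_nonneg (by omega)] at this; omega
      · omega
      · rw [abs_of_nonneg hr] at this; omega

/-- drop a root edge at `x` -/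
theorem Hyp.dec {k : ℤ} {ends : E → V × V} {S : Finset E} {W : Finset V} {c o i : V → ℤ}
    {x : V} (H : Hyp k ends S W c o i ∅)
    (hT : ∀ A ⊆ W, A ≠ W → 2 ≤ A.card → 2 ≤ F k ends S c o i A)
    (hxW : x ∈ W) (hox : 1 ≤ o x)
    (hx : nrm k (c x + o x - i x - 1) = nrm k (c x + o x - i x) - 1) :
    Hyp k ends S W c (fun v => o v - ind {v} x) i ∅ := by
  have hF : ∀ A, F k ends S c (fun v => o v - ind {v} x) i A = dS ends S A + ∑ v ∈ A, (o v + i v)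
      - ind A x - nrm k (∑ v ∈ A, (c v + o v - i v) + - ind A x) - (2 * k - 2) := by
    intro A
    unfold F
    have a1 : ∑ v ∈ A, (o v - ind {v} x + i v) = ∑ v ∈ A, (o v + i v) - ind A x := by
      rw [← ind_sum, ← Finset.sum_sub_distrib]
      exact Finset.sum_congr rfl fun v _ => by ring
    have a2 : ∑ v ∈ A, (c v + (o v - ind {v} x) - i v)
        = ∑ v ∈ A, (c v + o v - i v) + - ind A x := by
      rw [← ind_sum A x, ← sub_eq_add_neg, ← Finset.sum_sub_distrib]
      exact Finset.sum_congr rfl fun v _ => by ring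
    rw [a1, a2]; ring
  refine { H with onn := ?_, root := ?_, Uz := by simp, cut := ?_ }
  · intro v hv
    have := H.onn v hv
    by_cases h : x = v
    · subst h; simp [ind]; omega
    · simp [ind, h]; omega
  · rw [hF]
    have h := H.root
    unfold F at h
    have a1 : ind W x = 1 := by simp [ind, hxW]
    rw [a1]
    have := nrm_add_le' H.hk (∑ v ∈ W, (c v + o v - i v) + -1) 1
    rw [neg_add_cancel_right, abs_one] at this
    omega
  · intro A hA hne hAW _
    have h0 := H.cut A hA hne hAW (fun h => by rw [h] at hne; simp at hne)
    rw [hF]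
    rcases Nat.lt_or_ge A.card 2 with hc | hc
    · have : A.card = 1 := by have := hne.card_pos; omega
      obtain ⟨v, rfl⟩ := Finset.card_eq_one.1 this
      unfold F at h0
      rw [Finset.sum_singleton, Finset.sum_singleton] at h0 ⊢
      by_cases hvx : x = v
      · subst hvx
        have a1 : ind {x} x = 1 := by simp [ind]
        rw [a1, ← sub_eq_add_neg, hx]; omega
      · have a1 : ind {v} x = 0 := by simp [ind, hvx]
        rw [a1, neg_zero, add_zero]; omega
    · have h2 := hT A hA hAW hc
      unfold F at h2
      have := nrm_add_le' H.hk (∑ v ∈ A, (c v + o v - i v)) (- ind A x)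
      rw [abs_neg] at this
      generalize ∑ v ∈ A, (c v + o v - i v) = hA' at *
      rcases ind_cases A x with h | h <;> rw [h] at this ⊢ <;> norm_num at this ⊢ <;> omega

end

section
variable {V E : Type*} [DecidableEq V] [DecidableEq E]

theorem nrm_down {k : ℤ} (hk : 2 ≤ k) {h ρ : ℤ} (hρ : 2 * k ∣ h - ρ) (h1 : 1 ≤ ρ) (h2 : ρ ≤ k) :
    nrm k (h - 1) = nrm k h - 1 := by
  rw [nrm_of_rep hk h ρ hρ (by omega) (by omega),
    nrm_of_rep hk (h - 1) (ρ - 1) (by simpa using hρ) (by omega) (by omega)]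
  omega

theorem nrm_up {k : ℤ} (hk : 2 ≤ k) {h ρ : ℤ} (hρ : 2 * k ∣ h - ρ) (h1 : k ≤ ρ) (h2 : ρ < 2 * k) :
    nrm k (h + 1) = nrm k h - 1 := by
  rw [nrm_of_rep hk h ρ hρ (by omega) (by omega),
    nrm_of_rep hk (h + 1) (ρ + 1) (by simpa using hρ) (by omega) (by omega)]
  omega

theorem exists_cross {ends : E → V × V} {S : Finset E} {A : Finset V} (h : 0 < dS ends S A) :
    ∃ e ∈ S, cr A (ends e) = 1 := by
  by_contra hc
  push Not at hc
  have : dS ends S A = 0 := Finset.sum_eq_zero fun e he =>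
    (cr_cases A (ends e)).resolve_right (hc e he)
  omega

/-- Induction hypothesis. -/
def IHyp (E : Type*) [DecidableEq E] (k : ℤ) (W : Finset V) (m : ℕ) (p : ℤ) : Prop :=
  ∀ (ends' : E → V × V) (S' : Finset E) (W' : Finset V) (c' o' i' : V → ℤ) (U' : Finset V),
    Hyp k ends' S' W' c' o' i' U' →
    (W'.card < W.card ∨ (W' = W ∧ S'.card < m) ∨
      (W' = W ∧ S'.card = m ∧ ∑ v ∈ W, (o' v + i' v) < p)) → Sol k ends' S' W' c'

theorem Hyp.conn {k : ℤ} {ends : E → V × V} {S : Finset E} {W : Finset V} {c o i : V → ℤ}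
    (H : Hyp k ends S W c o i ∅) {A : Finset V} (hA : A ⊆ W) (hne : A.Nonempty) (hAW : A ≠ W) :
    ∃ e ∈ S, cr A (ends e) = 1 := by
  have h1 := H.cut A hA hne hAW (fun h => by rw [h] at hne; simp at hne)
  have hne2 : (W \ A).Nonempty := by
    rw [Finset.sdiff_nonempty]; intro h; exact hAW (Finset.Subset.antisymm hA h)
  have h2 := H.cut (W \ A) Finset.sdiff_subset hne2 (fun h => by
      obtain ⟨x, hx⟩ := hne
      have := hA hx
      rw [← h, Finset.mem_sdiff] at this
      exact this.2 hx)
    (fun h => by rw [h] at hne2; simp at hne2)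
  have := H.cut_big hA h1 h2
  have := H.hk
  exact exists_cross (by omega)

theorem joins_cross {A : Finset V} {p : V × V} (h : cr A p = 1) :
    ∃ x y, x ∈ A ∧ y ∉ A ∧ Joins p x y := by
  obtain ⟨a, b⟩ := p
  unfold cr at h
  by_cases h1 : a ∈ A <;> by_cases h2 : b ∈ A <;> simp [h1, h2] at h
  · exact ⟨a, b, h1, h2, Or.inl rfl⟩
  · exact ⟨b, a, h2, h1, Or.inr rfl⟩

theorem case_low {k : ℤ} {ends : E → V × V} {S : Finset E} {W : Finset V} {c o i : V → ℤ}
    (H : Hyp k ends S W c o i ∅) (hW : 2 ≤ W.card)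
    (hT : ∀ A ⊆ W, A ≠ W → 2 ≤ A.card → 2 ≤ F k ends S c o i A) {p : ℤ}
    (IH : IHyp E k W S.card p) (ho : ∀ v ∈ W, o v = 0)
    (hρ : ∀ v ∈ W, ∃ ρ, 2 * k ∣ c v + o v - i v - ρ ∧ 1 ≤ ρ ∧ ρ ≤ k - 1) : Sol k ends S W c := by
  have hk := H.hk
  obtain ⟨z, hz⟩ : W.Nonempty := Finset.card_pos.1 (by omega)
  obtain ⟨e, he, hcr⟩ := H.conn (A := {z}) (Finset.singleton_subset_iff.2 hz) (by simp)
    (fun h => by rw [← h] at hW; simp at hW)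
  obtain ⟨x, y, hx, hy, j⟩ := joins_cross hcr
  have hxy : x ≠ y := fun h => hy (h ▸ hx)
  obtain ⟨hxW, hyW⟩ := j.mem H.mem he
  obtain ⟨ρx, d1, a1, b1⟩ := hρ x hxW
  obtain ⟨ρy, d2, a2, b2⟩ := hρ y hyW
  apply del_sol he j
  refine IH _ _ _ _ _ _ _ (H.del hT he hxy j (k - ρy) (by omega) ?_ ?_ ?_) ?_
  · exact nrm_down hk d1 a1 (by omega)
  · rw [nrm_of_rep hk _ ρy d2 (by omega) (by omega), nrm_of_rep hk _ (k + 1) (by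
      have e : c y + o y - i y + 1 + (k - ρy) - (k + 1) = c y + o y - i y - ρy := by ring
      rw [e]; exact d2) (by omega) (by omega)]
    omega
  · have r0 := H.root
    unfold F at r0
    rw [dS_W H.mem] at r0
    set t := ∑ v ∈ W, i v with ht
    have ht0 : 0 ≤ t := Finset.sum_nonneg H.inn
    have e0 : ∑ v ∈ W, o v = 0 := Finset.sum_eq_zero ho
    have e1 : ∑ v ∈ W, (o v + i v) = t := by rw [Finset.sum_add_distrib, e0, zero_add]
    have e2 : ∑ v ∈ W, (c v + o v - i v) = ∑ v ∈ W, c v - t := by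
      rw [Finset.sum_sub_distrib, Finset.sum_add_distrib, e0, add_zero]
    rw [e1, e2] at r0 ⊢
    have e3 : nrm k (∑ v ∈ W, c v - t) = nrm k t := by
      rw [← nrm_neg hk t]
      apply nrm_congr hk
      have : ∑ v ∈ W, c v - t - -t = ∑ v ∈ W, c v := by ring
      rw [this]; exact H.sum
    have e4 : nrm k (∑ v ∈ W, c v - t + (k - ρy)) = nrm k (t - (k - ρy)) := by
      rw [← nrm_neg hk (t - _)]
      apply nrm_congr hk
      have : ∑ v ∈ W, c v - t + (k - ρy) - -(t - (k - ρy)) = ∑ v ∈ W, c v := by ring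
      rw [this]; exact H.sum
    rw [e3] at r0
    rw [e4]
    have t1 : t ≤ 2 * k - 1 := by
      by_contra hc
      have := nrm_le_abs hk t 1
      rw [abs_of_nonneg (by omega)] at this
      omega
    rcases le_total (k - ρy) t with h | h
    · rw [nrm_of_rep hk (t - (k - ρy)) (t - (k - ρy)) (by simp) (by omega) (by omega)]
      omega
    · rw [← nrm_neg hk, nrm_of_rep hk (-(t - (k - ρy))) ((k - ρy) - t) (by simp) (by omega)
        (by omega)]
      omega
  · right; left
    refine ⟨rfl, ?_⟩
    rw [Finset.card_erase_of_mem he]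
    have : 0 < S.card := Finset.card_pos.2 ⟨e, he⟩
    omega

theorem case_P {k : ℤ} {ends : E → V × V} {S : Finset E} {W : Finset V} {c o i : V → ℤ}
    (H : Hyp k ends S W c o i ∅) (hW : 2 ≤ W.card)
    (hT : ∀ A ⊆ W, A ≠ W → 2 ≤ A.card → 2 ≤ F k ends S c o i A)
    (IH : IHyp E k W S.card (∑ v ∈ W, (o v + i v)))
    (hz : ∀ v ∈ W, ¬ 2 * k ∣ c v + o v - i v) : Sol k ends S W c := by
  have hk := H.hk
  have hTn : ∀ A ⊆ W, A ≠ W → 2 ≤ A.card → 2 ≤ F k ends S (fun v => - c v) i o A := by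
    intro A h1 h2 h3; rw [F_neg hk]; exact hT A h1 h2 h3
  set ρ : V → ℤ := fun v => (c v + o v - i v) % (2 * k) with hρ
  have r1 : ∀ v ∈ W, 1 ≤ ρ v := by
    intro v hv
    have h1 := Int.emod_nonneg (c v + o v - i v) (show (2 * k) ≠ 0 by omega)
    have h2 : (c v + o v - i v) % (2 * k) ≠ 0 := fun h => hz v hv (Int.dvd_of_emod_eq_zero h)
    simp only [hρ]; omega
  have r2 : ∀ v, ρ v < 2 * k := fun v => Int.emod_lt_of_pos _ (by omega)
  have r3 : ∀ v, 2 * k ∣ c v + o v - i v - ρ v := fun v => Int.dvd_self_sub_emod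
  by_cases c1 : ∃ x ∈ W, 1 ≤ o x ∧ ρ x ≤ k
  · obtain ⟨x, hx, hox, hxk⟩ := c1
    refine IH _ _ _ _ _ _ _ (H.dec hT hx hox (nrm_down hk (r3 x) (r1 x hx) hxk)) ?_
    right; right
    refine ⟨rfl, rfl, Finset.sum_lt_sum (fun v hv => ?_) ⟨x, hx, ?_⟩⟩
    · rcases ind_cases {v} x with h | h <;> rw [h] <;> omega
    · simp [ind]
  by_cases c2 : ∃ x ∈ W, 1 ≤ i x ∧ k ≤ ρ x
  · obtain ⟨x, hx, hox, hxk⟩ := c2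
    apply Sol.neg
    refine IH _ _ _ _ _ _ _ (H.neg.dec hTn hx hox ?_) ?_
    · have := nrm_up hk (r3 x) hxk (r2 x)
      have e1 : - c x + i x - o x - 1 = -(c x + o x - i x + 1) := by ring
      have e2 : - c x + i x - o x = -(c x + o x - i x) := by ring
      rw [e1, e2, nrm_neg hk, nrm_neg hk]; exact this
    right; right
    refine ⟨rfl, rfl, Finset.sum_lt_sum (fun v hv => ?_) ⟨x, hx, ?_⟩⟩
    · rcases ind_cases {v} x with h | h <;> rw [h] <;> omega
    · simp [ind]; omega
  by_cases c3 : ∃ e ∈ S, ∃ x y, x ≠ y ∧ Joins (ends e) x y ∧ ρ x ≤ k ∧ k ≤ ρ y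
  · obtain ⟨e, he, x, y, hxy, j, hx, hy⟩ := c3
    obtain ⟨hxW, hyW⟩ := j.mem H.mem he
    apply del_sol he j
    refine IH _ _ _ _ _ _ _ (H.del hT he hxy j 0 le_rfl ?_ ?_ ?_) ?_
    · exact nrm_down hk (r3 x) (r1 x hxW) hx
    · rw [add_zero, add_zero]
      exact nrm_up hk (r3 y) hy (r2 y)
    · have := H.root
      unfold F at this
      rw [dS_W H.mem] at this
      rw [add_zero, add_zero]; omega
    · right; left
      refine ⟨rfl, ?_⟩
      rw [Finset.card_erase_of_mem he]
      have : 0 < S.card := Finset.card_pos.2 ⟨e, he⟩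
      omega
  push Not at c1 c2 c3
  have key : ∀ e ∈ S, ∀ x y, x ≠ y → Joins (ends e) x y →
      (ρ x < k ∧ ρ y < k) ∨ (k < ρ x ∧ k < ρ y) := by
    intro e he x y hxy j
    have h1 := c3 e he x y hxy j
    have h2 := c3 e he y x hxy.symm j.symm
    by_contra hc
    rcases lt_trichotomy (ρ x) k with h | h | h <;> rcases lt_trichotomy (ρ y) k with h' | h' | h'
      <;> omega
  have nek : ∀ v ∈ W, ρ v ≠ k := by
    intro v hv h
    obtain ⟨e, he, hcr⟩ := H.conn (A := {v}) (Finset.singleton_subset_iff.2 hv) (by simp)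
      (fun h => by rw [← h] at hW; simp at hW)
    obtain ⟨y, hy, j⟩ := joins_of_cr hcr
    have := key e he v y hy.symm j
    omega
  by_cases cA : W.filter (fun v => ρ v < k) = ∅
  · have hi : ∀ v ∈ W, k < ρ v := by
      intro v hv
      have := nek v hv
      have h2 : v ∉ W.filter (fun v => ρ v < k) := by rw [cA]; simp
      rw [Finset.mem_filter] at h2
      push Not at h2
      have := h2 hv
      omega
    apply Sol.neg
    refine case_low H.neg hW hTn IH ?_ ?_
    · intro v hv
      have h1 := H.inn v hv
      have h2 := hi v hv
      by_contra hne
      have := c2 v hv (by omega)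
      omega
    · intro v hv
      refine ⟨2 * k - ρ v, ?_, ?_, ?_⟩
      · have := (r3 v).neg_right.sub (dvd_refl (2 * k))
        have e : -(c v + o v - i v - ρ v) - 2 * k = - c v + i v - o v - (2 * k - ρ v) := by ring
        rwa [e] at this
      · have := r2 v; omega
      · have := hi v hv; omega
  · have hall : W.filter (fun v => ρ v < k) = W := by
      by_contra hne
      obtain ⟨e, he, hcr⟩ := H.conn (Finset.filter_subset (fun v => ρ v < k) W)
        (Finset.nonempty_iff_ne_empty.2 cA) hne
      obtain ⟨x, y, hx, hy, j⟩ := joins_cross hcr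
      have hxy : x ≠ y := fun h => hy (h ▸ hx)
      obtain ⟨hxW, hyW⟩ := j.mem H.mem he
      have := key e he x y hxy j
      rw [Finset.mem_filter] at hx hy
      push Not at hy
      have := hy hyW
      omega
    have hlo : ∀ v ∈ W, ρ v < k := fun v hv => by
      rw [← hall] at hv; exact (Finset.mem_filter.1 hv).2
    refine case_low H hW hT IH ?_ ?_
    · intro v hv
      have h1 := H.onn v hv
      have h2 := hlo v hv
      by_contra hne
      have := c1 v hv (by omega)
      omega
    · intro v hv
      exact ⟨ρ v, r3 v, r1 v hv, by have := hlo v hv; omega⟩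

theorem card_col_lt {W A : Finset V} {a : V} (hA : A ⊆ W) (h2 : 2 ≤ A.card) (ha : a ∈ A) :
    (W.image (col A a)).card < W.card := by
  refine lt_of_le_of_ne Finset.card_image_le fun h => ?_
  have hinj := Finset.card_image_iff.1 h
  obtain ⟨b, hb, hba⟩ := Finset.exists_mem_ne (by omega : 1 < A.card) a
  exact hba (hinj (hA hb) (hA ha) (by simp [col, hb, ha]))

theorem case_Z {k : ℤ} {ends : E → V × V} {S : Finset E} {W : Finset V} {c o i : V → ℤ} {u : V}
    (H : Hyp k ends S W c o i {u}) (hW : 3 ≤ W.card)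
    (hT : ∀ A ⊆ W, A ≠ W → 2 ≤ A.card → 2 ≤ F k ends S c o i A) {p : ℤ}
    (IH : IHyp E k W S.card p) : Sol k ends S W c := by
  have hk := H.hk
  have hu : u ∈ W := H.Usub (by simp)
  by_cases c1 : ∃ e1 ∈ S, ∃ e2 ∈ S, ∃ y1 y2, y1 ≠ y2 ∧ y1 ≠ u ∧ y2 ≠ u ∧
      Joins (ends e1) y1 u ∧ Joins (ends e2) u y2
  · obtain ⟨e1, h1, e2, h2, y1, y2, h12, n1, n2, j1, j2⟩ := c1
    have he : e1 ≠ e2 := by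
      rintro rfl
      rcases j1 with h | h <;> rcases j2 with h' | h' <;> rw [h] at h' <;>
        simp only [Prod.mk.injEq] at h'
      · exact n1 h'.1
      · exact h12 h'.1
      · exact h12 h'.2
      · exact n1 h'.2
    apply lift_sol he h1 h2 j1 j2
    refine IH _ _ _ _ _ _ _ (H.lift hT he h1 h2 h12 j1 j2) ?_
    right; left
    refine ⟨rfl, ?_⟩
    rw [Finset.card_erase_of_mem h2]
    have : 0 < S.card := Finset.card_pos.2 ⟨e2, h2⟩
    omega
  · push Not at c1
    have hy : ∃ y ∈ W, y ≠ u ∧ ∀ e ∈ S, cr {u} (ends e) = 1 → cr {u, y} (ends e) = 0 := by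
      by_cases c2 : ∃ e ∈ S, cr {u} (ends e) = 1
      · obtain ⟨e0, he0, h0⟩ := c2
        obtain ⟨y, hy, j0⟩ := joins_of_cr h0
        refine ⟨y, (j0.mem H.mem he0).2, hy, ?_⟩
        intro e he hcr
        obtain ⟨y', hy', j⟩ := joins_of_cr hcr
        have : y = y' := by
          by_contra hne
          exact c1 e0 he0 e he y y' hne hy hy' j0.symm j
        subst this
        rw [j.cr_eq]; simp [cr]
      · push Not at c2
        obtain ⟨y, hy, hyu⟩ := Finset.exists_mem_ne (by omega : 1 < W.card) u
        exact ⟨y, hy, hyu, fun e he h => absurd h (c2 e he)⟩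
    obtain ⟨y, hyW, hyu, hN⟩ := hy
    have hsub : ({u, y} : Finset V) ⊆ W := by
      intro x hx
      rw [Finset.mem_insert, Finset.mem_singleton] at hx
      rcases hx with rfl | rfl <;> assumption
    have hcard : ({u, y} : Finset V).card = 2 := Finset.card_pair hyu.symm
    have hpar := H.par {u} (Finset.singleton_subset_iff.2 hu)
    rw [Finset.sum_singleton] at hpar
    have hWc : (W \ {u}).card = W.card - 1 := by
      rw [Finset.sdiff_singleton_eq_erase, Finset.card_erase_of_mem hu]
    refine pend hk H.mem hyu.symm hu hyW hN hpar (H.single hu ?_ ?_) ?_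
    · apply Finset.card_pos.1; omega
    · intro h; rw [h] at hWc; simp at hWc; omega
    · refine IH _ _ _ _ _ _ _ (hyp_collapse H {u, y} y (by simp) hsub (by omega)) ?_
      left
      exact card_col_lt hsub (by omega) (by simp)

theorem thmL_step {k : ℤ} {ends : E → V × V} {S : Finset E} {W : Finset V} {c o i : V → ℤ}
    {U : Finset V} (H : Hyp k ends S W c o i U)
    (IH : IHyp E k W S.card (∑ v ∈ W, (o v + i v))) : Sol k ends S W c := by
  have hk := H.hk
  rcases Nat.lt_or_ge W.card 2 with h1 | h1
  · refine ⟨fun _ => 1, fun _ => Or.inl rfl, fun v hv => ?_⟩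
    have hWv : W = {v} := by
      apply Finset.Subset.antisymm
      · intro x hx
        rw [Finset.mem_singleton]
        exact Finset.card_le_one.1 (by omega) x hx v hv
      · simpa using hv
    have h2 := H.sum
    have h0 : nt ends S (fun _ => 1) {v} = 0 := by
      refine Finset.sum_eq_zero fun e he => ?_
      have := H.mem e he
      rw [hWv] at this
      unfold ind
      rw [if_pos this.1, if_pos this.2]; ring
    rw [hWv, Finset.sum_singleton] at h2
    rw [h0, zero_sub]; exact h2.neg_right
  rcases Nat.lt_or_ge W.card 3 with h2 | h2
  · have : W.card = 2 := by omega
    obtain ⟨u, y, huy, hWe⟩ : ∃ u y, u ≠ y ∧ W = {u, y} ∧ ({y} : Finset V) ≠ U := by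
      obtain ⟨u, y, huy, hWe⟩ := Finset.card_eq_two.1 this
      by_cases h : ({y} : Finset V) = U
      · refine ⟨y, u, huy.symm, by rw [hWe, Finset.pair_comm], ?_⟩
        rw [← h]; intro h'; exact huy (Finset.singleton_injective h')
      · exact ⟨u, y, huy, hWe, h⟩
    obtain ⟨rfl, hU⟩ := hWe
    have hs : ({u, y} : Finset V) \ {u} = {y} := by
      ext x; simp only [Finset.mem_sdiff, Finset.mem_insert, Finset.mem_singleton]
      constructor
      · rintro ⟨h | h, h'⟩
        · exact absurd h h'
        · exact h
      · rintro rfl; exact ⟨Or.inr rfl, huy.symm⟩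
    have hpar := H.par {u} (by simp)
    rw [Finset.sum_singleton] at hpar
    have hsum := H.sum
    rw [Finset.sum_pair huy] at hsum
    exact two_sol hk huy H.mem hsum hpar (H.single (by simp) (by rw [hs]; simp) (by rw [hs]; exact hU))
  by_cases cT : ∃ A ⊆ W, A ≠ W ∧ 2 ≤ A.card ∧ F k ends S c o i A ≤ 0
  · obtain ⟨A, hA, hAW, hA2, hFA⟩ := cT
    obtain ⟨a, ha⟩ : A.Nonempty := Finset.card_pos.1 (by omega)
    refine contract_step H.mem A a ha hA ?_ ?_
    · exact IH _ _ _ _ _ _ _ (hyp_collapse H A a ha hA hA2) (Or.inl (card_col_lt hA hA2 ha))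
    · intro ε hε hsum
      obtain ⟨o', i', H'⟩ := hyp_restrict (U := U ∩ A) hk (fun v hv => H.onn v (hA hv))
        (fun v hv => H.inn v (hA hv)) (fun B hB => H.par B (hB.trans hA)) hFA
        Finset.inter_subset_right ((Finset.card_le_card Finset.inter_subset_left).trans H.Ucard)
        (fun u hu => H.Uz u (Finset.mem_inter.1 hu).1)
        (fun B hB hne hBA hBU => H.cut B (hB.trans hA) hne
          (fun h => hAW (Finset.Subset.antisymm hA (h ▸ hB)))
          (fun h => hBU (by
            rw [← h]; exact (Finset.inter_eq_left.2 hB).symm))) ε hε hsum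
      refine IH _ _ _ _ _ _ _ H' (Or.inl ?_)
      exact Finset.card_lt_card (Finset.ssubset_iff_subset_ne.2 ⟨hA, hAW⟩)
  push Not at cT
  have hT : ∀ A ⊆ W, A ≠ W → 2 ≤ A.card → 2 ≤ F k ends S c o i A := by
    intro A h1 h2 h3
    have := cT A h1 h2 h3
    have := H.F_even h1
    omega
  by_cases cU : U = ∅
  · subst cU
    by_cases cz : ∃ u ∈ W, 2 * k ∣ c u + o u - i u
    · obtain ⟨u, hu, hz⟩ := cz
      have H' : Hyp k ends S W c o i {u} := 
        { H with
          Usub := by simpa using hu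
          Ucard := by simp
          Uz := by intro v hv; rw [Finset.mem_singleton] at hv; rw [hv]; exact hz
          cut := fun A a1 a2 a3 a4 => H.cut A a1 a2 a3 (fun h => by rw [h] at a2; simp at a2) }
      exact case_Z H' h2 hT IH
    · push Not at cz
      exact case_P H h1 hT IH cz
  · obtain ⟨u, hu⟩ := Finset.nonempty_iff_ne_empty.2 cU
    have : U = {u} := by
      apply Finset.Subset.antisymm
      · intro x hx
        rw [Finset.mem_singleton]
        exact Finset.card_le_one.1 H.Ucard x hx u hu
      · simpa using hu
    subst this
    exact case_Z H h2 hT IH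

theorem thmL {k : ℤ} {ends : E → V × V} {S : Finset E} {W : Finset V} {c o i : V → ℤ}
    {U : Finset V} (H : Hyp k ends S W c o i U) : Sol k ends S W c := by
  suffices h : ∀ n m p : ℕ, ∀ (ends : E → V × V) (S : Finset E) (W : Finset V) (c o i : V → ℤ)
      (U : Finset V), Hyp k ends S W c o i U → W.card = n → S.card = m →
      (∑ v ∈ W, (o v + i v)).toNat = p → Sol k ends S W c from
    h _ _ _ ends S W c o i U H rfl rfl rfl
  intro n
  induction n using Nat.strong_induction_on with
  | _ n ihn =>
  intro m
  induction m using Nat.strong_induction_on with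
  | _ m ihm =>
  intro p
  induction p using Nat.strong_induction_on with
  | _ p ihp =>
  intro ends S W c o i U H hn hm hp
  apply thmL_step H
  intro ends' S' W' c' o' i' U' H' h
  rcases h with h | ⟨rfl, h⟩ | ⟨rfl, h, h'⟩
  · exact ihn _ (by omega) _ _ ends' S' W' c' o' i' U' H' rfl rfl rfl
  · exact ihm _ (by omega) _ ends' S' W' c' o' i' U' H' hn rfl rfl
  · have : 0 ≤ ∑ v ∈ W', (o' v + i' v) :=
      Finset.sum_nonneg fun v hv => add_nonneg (H'.onn v hv) (H'.inn v hv)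
    exact ihp _ (by omega) ends' S' W' c' o' i' U' H' hn (by omega) rfl

end

section
variable {V E ι : Type*} [DecidableEq V] [DecidableEq E] [DecidableEq ι]

/-- cut-connectedness of an edge set -/
def Cn (ends : E → V × V) (T : Finset E) (W : Finset V) : Prop :=
  ∀ A ⊆ W, A.Nonempty → A ≠ W → ∃ e ∈ T, cr A (ends e) = 1

/-- cut-connectedness after removing `v` -/
def Cn' (ends : E → V × V) (T : Finset E) (W : Finset V) (v : V) : Prop :=
  ∀ A ⊆ W \ {v}, A.Nonempty → A ≠ W \ {v} → ∃ e ∈ T, cr A (ends e) = 1 ∧ cr {v} (ends e) = 0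

/-- base hypotheses -/
structure TB (k : ℤ) (ends : E → V × V) (S : Finset E) (W : Finset V) (c : V → ℤ)
    (T : ι → Finset E) : Prop where
  mem : ∀ e ∈ S, (ends e).1 ∈ W ∧ (ends e).2 ∈ W
  par : ∀ A ⊆ W, 2 ∣ dS ends S A - ∑ v ∈ A, c v
  sum : 2 * k ∣ ∑ v ∈ W, c v
  sub : ∀ i, T i ⊆ S
  disj : ∀ i j, i ≠ j → Disjoint (T i) (T j)

theorem exists_min {ends : E → V × V} {T : Finset E} {W : Finset V} (h : Cn ends T W) :
    ∃ M ⊆ T, Cn ends M W ∧ ∀ e ∈ M, ¬ Cn ends (M.erase e) W := by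
  classical
  obtain ⟨M, hM, hmin⟩ := Finset.exists_min_image (T.powerset.filter fun M => Cn ends M W)
    Finset.card ⟨T, by simpa using h⟩
  rw [Finset.mem_filter, Finset.mem_powerset] at hM
  refine ⟨M, hM.1, hM.2, fun e he hc => ?_⟩
  have := hmin (M.erase e) (by
    rw [Finset.mem_filter, Finset.mem_powerset]
    exact ⟨(Finset.erase_subset _ _).trans hM.1, hc⟩)
  rw [Finset.card_erase_of_mem he] at this
  have : 0 < M.card := Finset.card_pos.2 ⟨e, he⟩
  omega

theorem cr_sdiff {W A : Finset V} {p : V × V} (h : p.1 ∈ W ∧ p.2 ∈ W) :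
    cr (W \ A) p = cr A p := by
  simp [cr, h, not_iff_not]

/-- a bridge gives a cut -/
theorem bridge {ends : E → V × V} {M : Finset E} {W : Finset V} {e : E} {u v : V}
    (mem : ∀ e ∈ M, (ends e).1 ∈ W ∧ (ends e).2 ∈ W)
    (h : Cn ends M W) (he : e ∈ M) (hn : ¬ Cn ends (M.erase e) W) (j : Joins (ends e) u v) :
    ∃ A ⊆ W, u ∈ A ∧ v ∉ A ∧ ∀ e' ∈ M, cr A (ends e') = 1 → e' = e := by
  unfold Cn at hn
  push Not at hn
  obtain ⟨A, hA, hne, hAW, hc⟩ := hn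
  have huniq : ∀ e' ∈ M, cr A (ends e') = 1 → e' = e := by
    intro e' he' h1
    by_contra h2
    exact hc e' (Finset.mem_erase.2 ⟨h2, he'⟩) h1
  obtain ⟨e', he', hcr⟩ := h A hA hne hAW
  have := huniq e' he' hcr
  subst this
  rw [j.cr_eq] at hcr
  obtain ⟨hu, hv⟩ := j.mem mem he
  by_cases h1 : u ∈ A
  · refine ⟨A, hA, h1, ?_, huniq⟩
    intro h2; simp [cr, h1, h2] at hcr
  · refine ⟨W \ A, Finset.sdiff_subset, by simp [hu, h1], ?_, ?_⟩
    · have : v ∈ A := by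
        by_contra h2; simp [cr, h1, h2] at hcr
      simp [this]
    · intro e'' he'' h2
      rw [cr_sdiff (mem e'' he'')] at h2
      exact huniq e'' he'' h2

/-- unique edge at v -/
theorem cn_unique {ends : E → V × V} {T : Finset E} {W : Finset V} {f : E} {v w : V}
    (mem : ∀ e ∈ T, (ends e).1 ∈ W ∧ (ends e).2 ∈ W)
    (h : Cn ends T W) (hv : v ∈ W) (hf : Joins (ends f) v w) 
    (hu : ∀ e ∈ T, cr {v} (ends e) = 1 → e = f) : Cn' ends (T.erase f) W v := by
  intro A hA hne hAW
  have hvA : v ∉ A := fun h => by have := hA h; simp at this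
  by_cases hw : w ∈ A
  · obtain ⟨e, he, hcr⟩ := h (insert v A) (by
      intro x hx
      rw [Finset.mem_insert] at hx
      rcases hx with rfl | hx
      · exact hv
      · exact (Finset.mem_sdiff.1 (hA hx)).1) ⟨v, by simp⟩ (by
        intro h
        apply hAW
        rw [← h]; ext x
        simp only [Finset.mem_sdiff, Finset.mem_insert, Finset.mem_singleton]
        constructor
        · intro hx; exact ⟨Or.inr hx, fun h => hvA (h ▸ hx)⟩
        · rintro ⟨h1 | h1, h2⟩
          · exact absurd h1 h2
          · exact h1)
    have hef : e ≠ f := by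
      rintro rfl
      rw [hf.cr_eq] at hcr
      simp [cr, hw] at hcr
    have hc0 : cr {v} (ends e) = 0 := (cr_cases _ _).resolve_right fun h => hef (hu e he h)
    refine ⟨e, Finset.mem_erase.2 ⟨hef, he⟩, ?_, hc0⟩
    unfold cr at hcr hc0 ⊢
    by_cases h1 : (ends e).1 = v <;> by_cases h2 : (ends e).2 = v <;>
      simp [h1, h2] at hcr hc0 ⊢ <;> exact hcr
  · obtain ⟨e, he, hcr⟩ := h A (hA.trans Finset.sdiff_subset) hne (by
      intro h; rw [h] at hvA; exact hvA hv)
    have hef : e ≠ f := by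
      rintro rfl
      rw [hf.cr_eq] at hcr
      simp [cr, hw, hvA] at hcr
    exact ⟨e, Finset.mem_erase.2 ⟨hef, he⟩, hcr,
      (cr_cases _ _).resolve_right fun h => hef (hu e he h)⟩

theorem Cn'.mono {ends : E → V × V} {T T' : Finset E} {W : Finset V} {v : V}
    (h : Cn' ends T W v) (hT : T ⊆ T') : Cn' ends T' W v := by
  intro A h1 h2 h3
  obtain ⟨e, he, hh⟩ := h A h1 h2 h3
  exact ⟨e, hT he, hh⟩

/-- two bridges -/
theorem two_bridges {ends : E → V × V} {M : Finset E} {W A1 A2 : Finset V} {e1 e2 : E} {v : V}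
    {u1 u2 w : V} (h : Cn ends M W) (hv : v ∈ W) (h12 : e1 ≠ e2) (h1 : e1 ∈ M) (h2 : e2 ∈ M)
    (j1 : Joins (ends e1) u1 v) (j2 : Joins (ends e2) u2 v)
    (s1 : A1 ⊆ W) (v1 : v ∉ A1) (v2 : v ∉ A2)
    (q1 : ∀ e' ∈ M, cr A1 (ends e') = 1 → e' = e1) (q2 : ∀ e' ∈ M, cr A2 (ends e') = 1 → e' = e2) :
    w ∉ A1 ∨ w ∉ A2 := by
  by_contra hc
  push Not at hc
  obtain ⟨e, he, hcr⟩ := h (A1 ∩ A2) (Finset.inter_subset_left.trans s1)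
    ⟨w, Finset.mem_inter.2 hc⟩ (fun h => by rw [← h] at hv; exact v1 (Finset.mem_inter.1 hv).1)
  have hor : cr A1 (ends e) = 1 ∨ cr A2 (ends e) = 1 := by
    by_contra hn
    push Not at hn
    have a1 := (cr_cases A1 (ends e)).resolve_right hn.1
    have a2 := (cr_cases A2 (ends e)).resolve_right hn.2
    unfold cr at hcr a1 a2
    simp at hcr a1 a2
    simp only [a1, a2] at hcr
    exact hcr trivial
  rcases hor with h' | h'
  · have := q1 e he h'
    subst this
    apply h12
    apply q2 e he
    rw [j1.cr_eq] at hcr ⊢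
    unfold cr at hcr ⊢
    by_cases a : u1 ∈ A2
    · simp [a, v2]
    · simp [a, v2] at hcr
  · have := q2 e he h'
    subst this
    apply h12
    symm
    apply q1 e he
    rw [j2.cr_eq] at hcr ⊢
    unfold cr at hcr ⊢
    by_cases a : u2 ∈ A1
    · simp [a, v1]
    · simp [a, v1] at hcr

/-- swing a bridge -/
theorem swing {ends : E → V × V} {M : Finset E} {W A1 : Finset V} {e1 : E} {v u1 w : V}
    (h : Cn ends M W) (h1 : e1 ∈ M) (j1 : Joins (ends e1) u1 v)
    (s1 : A1 ⊆ W) (u1A : u1 ∈ A1) (v1 : v ∉ A1) (hw : w ∈ W) (hwA : w ∉ A1)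
    (q1 : ∀ e' ∈ M, cr A1 (ends e') = 1 → e' = e1) :
    Cn (Function.update ends e1 (u1, w)) M W := by
  intro B hB hne hBW
  by_contra hc
  push Not at hc
  have hc1 := hc e1 h1
  rw [Function.update_self] at hc1
  have hq : ∀ e ∈ M, e ≠ e1 → cr B (ends e) = 0 := by
    intro e he hne
    have := hc e he
    rw [Function.update_of_ne hne] at this
    exact (cr_cases _ _).resolve_right this
  have hB1 : cr B (ends e1) = 1 := by
    obtain ⟨e, he, hcr⟩ := h B hB hne hBW
    by_cases h : e = e1
    · rw [← h]; exact hcr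
    · have := hq e he h; omega
  have hnc : ∀ e ∈ M, cr (symmDiff B A1) (ends e) ≠ 1 := by
    intro e he
    by_cases hh : e = e1
    · subst hh
      rw [j1.cr_eq] at hB1 ⊢
      unfold cr at hB1 ⊢
      by_cases a : u1 ∈ B <;> by_cases b : v ∈ B <;>
        simp [a, b, u1A, v1, Finset.mem_symmDiff] at hB1 ⊢
    · have a1 := hq e he hh
      have a2 : cr A1 (ends e) = 0 := (cr_cases _ _).resolve_right fun h => hh (q1 e he h)
      unfold cr at a1 a2 ⊢
      simp [Finset.mem_symmDiff] at a1 a2 ⊢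
      rw [a1, a2]
  have hsub : symmDiff B A1 ⊆ W := by
    intro x hx
    rw [Finset.mem_symmDiff] at hx
    rcases hx with hx | hx
    · exact hB hx.1
    · exact s1 hx.1
  have hu1w : cr B (u1, w) = 0 := (cr_cases _ _).resolve_right hc1
  unfold cr at hu1w
  simp at hu1w
  by_cases hz : symmDiff B A1 = ∅
  · have : u1 ∉ symmDiff B A1 := by rw [hz]; simp
    have h' : w ∉ symmDiff B A1 := by rw [hz]; simp
    rw [Finset.mem_symmDiff] at this h'
    tauto
  · by_cases hWW : symmDiff B A1 = W
    · have : u1 ∈ symmDiff B A1 := by rw [hWW]; exact s1 u1A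
      have h' : w ∈ symmDiff B A1 := by rw [hWW]; exact hw
      rw [Finset.mem_symmDiff] at this h'
      tauto
    · obtain ⟨e, he, hcr⟩ := h _ hsub (Finset.nonempty_iff_ne_empty.2 hz) hWW
      exact hnc e he hcr

theorem star' {k : ℤ} (hk : 2 ≤ k) (ends : E → V × V) (S : Finset E) (u : V) (c : ℤ)
    (hpar : 2 ∣ dS ends S {u} - c) (hc : nrm k c ≤ dS ends S {u}) :
    ∃ ε : E → ℤ, IsSign ε ∧ 2 * k ∣ nt ends S ε {u} - c := by
  set R := S.filter fun e => cr {u} (ends e) = 1 with hR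
  have hRS : R ⊆ S := Finset.filter_subset _ _
  have h0 : ∀ e ∈ S \ R, cr {u} (ends e) = 0 := by
    intro e he
    rw [Finset.mem_sdiff, hR, Finset.mem_filter] at he
    exact (cr_cases _ _).resolve_right fun h => he.2 ⟨he.1, h⟩
  have hd : dS ends R {u} = dS ends S {u} := by
    rw [dS_split ends S R hRS]
    have : dS ends (S \ R) {u} = 0 := Finset.sum_eq_zero h0
    omega
  obtain ⟨ε, hε, h⟩ := star hk ends R u (fun e he => (Finset.mem_filter.1 he).2) c
    (by rw [hd]; exact hpar) (by rw [hd]; exact hc)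
  refine ⟨ε, hε, ?_⟩
  have h1 : nt ends S ε {u} = nt ends R ε {u} := by
    rw [nt_split ends S R hRS]
    have : nt ends (S \ R) ε {u} = 0 := Finset.sum_eq_zero fun e he => by
      have := h0 e he
      rw [cr_eq_abs, abs_eq_zero] at this
      rw [this, mul_zero]
    omega
  rw [h1]; exact h

/-- induction hypothesis of the tree theorem -/
def IHT (V E ι : Type*) [DecidableEq V] [DecidableEq E] [DecidableEq ι] (k : ℤ) (n : ℕ) : Prop :=
  ∀ (ends : E → V × V) (S : Finset E) (W : Finset V) (c : V → ℤ) (T : ι → Finset E),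
    W.card < n → TB k ends S W c T → (∀ i, Cn ends (T i) W) → Sol k ends S W c

/-- delete the vertex `v` -/
theorem del_vertex {k : ℤ} (hk : 2 ≤ k) {ends : E → V × V} {S : Finset E} {W : Finset V}
    {c : V → ℤ} {T : ι → Finset E} {v : V} (IH : IHT V E ι k W.card) (H : TB k ends S W c T)
    (hv : v ∈ W) (hc : nrm k (c v) ≤ dS ends S {v}) (hT : ∀ i, Cn' ends (T i) W v) :
    Sol k ends S W c := by
  set A := W \ {v} with hA
  have hvA : v ∉ A := by simp [hA]
  set R := outE ends S A with hR
  have hRS : R ⊆ S := outE_sub ends S A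
  have hpar := H.par {v} (Finset.singleton_subset_iff.2 hv)
  rw [Finset.sum_singleton] at hpar
  have hin : ∀ e ∈ S \ R, (ends e).1 ≠ v ∧ (ends e).2 ≠ v := by
    intro e he
    have := (mem_inE he).2
    exact ⟨fun h => hvA (h ▸ this.1), fun h => hvA (h ▸ this.2)⟩
  have hd : dS ends R {v} = dS ends S {v} := by
    rw [dS_split ends S R hRS]
    have : dS ends (S \ R) {v} = 0 := Finset.sum_eq_zero fun e he => by
      have := hin e he
      simp [cr, this.1, this.2]
    omega
  obtain ⟨ε, hε, h⟩ := star' hk ends R v (c v) (by rw [hd]; exact hpar) (by rw [hd]; exact hc)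
  apply sol_partial hRS ε hε
  have hAW : A.card < W.card := by
    rw [hA, Finset.sdiff_singleton_eq_erase]
    exact Finset.card_erase_lt_of_mem hv
  have hvs : ({v} : Finset V) ⊆ W := Finset.singleton_subset_iff.2 hv
  have hsum : ∑ x ∈ A, c x + c v = ∑ x ∈ W, c x := by
    have := Finset.sum_sdiff (f := c) hvs
    rwa [Finset.sum_singleton] at this
  have hnt : nt ends R ε A + nt ends R ε {v} = 0 := by
    have h1 := Finset.sum_sdiff (f := fun x => nt ends R ε {x}) hvs
    rw [Finset.sum_singleton, nt_sum, nt_sum] at h1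
    rw [h1]
    refine Finset.sum_eq_zero fun e he => ?_
    have := H.mem e (hRS he)
    unfold ind
    rw [if_pos this.1, if_pos this.2]; ring
  have hTB : TB k ends (S \ R) A (fun v => c v - nt ends R ε {v}) (fun i => T i \ R) := by
    constructor
    · intro e he; exact (mem_inE he).2
    · intro B hB
      have h1 := H.par B (hB.trans Finset.sdiff_subset)
      have h2 := nt_par ends R ε hε B
      rw [dS_split ends S R hRS] at h1
      rw [Finset.sum_sub_distrib, nt_sum]
      omega
    · rw [Finset.sum_sub_distrib, nt_sum]
      have := H.sum.add h
      have e : ∑ x ∈ A, c x - nt ends R ε A = ∑ x ∈ W, c x + (nt ends R ε {v} - c v) := by omega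
      rw [e]; exact this
    · intro i; exact Finset.sdiff_subset_sdiff (H.sub i) (Finset.Subset.refl _)
    · intro i j hij
      exact (H.disj i j hij).mono Finset.sdiff_subset Finset.sdiff_subset
  obtain ⟨ε', hε', hs'⟩ := IH ends (S \ R) A _ (fun i => T i \ R) hAW hTB (by
    intro i B hB hne hBA
    obtain ⟨e, he, h1, h2⟩ := hT i B hB hne hBA
    refine ⟨e, Finset.mem_sdiff.2 ⟨he, ?_⟩, h1⟩
    intro heR
    have h3 := (Finset.mem_filter.1 heR).2
    have h4 := H.mem e (hRS heR)
    have h5 : (ends e).1 = v ∨ (ends e).2 = v := by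
      by_contra hc
      push Not at hc
      apply h3
      simp [hA, h4, hc]
    unfold cr at h1 h2
    simp at h1 h2
    have : (ends e).1 = v ∧ (ends e).2 = v := by tauto
    rw [this.1, this.2] at h1
    exact h1 Iff.rfl)
  refine ⟨ε', hε', fun x hx => ?_⟩
  by_cases hxv : x = v
  · subst hxv
    have h0 : nt ends (S \ R) ε' {x} = 0 := Finset.sum_eq_zero fun e he => by
      have := hin e he
      simp [ind, this.1, this.2]
    rw [h0]
    have e : 0 - (c x - nt ends R ε {x}) = nt ends R ε {x} - c x := by ring
    rw [e]; exact h
  · exact hs' x (by simp [hA, hx, hxv])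

end

section
variable {V E ι : Type*} [DecidableEq V] [DecidableEq E] [DecidableEq ι]

theorem sum_trees_le {ends : E → V × V} {S : Finset E} {T : ι → Finset E} (J : Finset ι)
    (sub : ∀ i, T i ⊆ S) (disj : ∀ i j, i ≠ j → Disjoint (T i) (T j)) (A : Finset V) :
    ∑ i ∈ J, dS ends (T i) A ≤ dS ends S A := by
  unfold dS
  rw [← Finset.sum_biUnion (fun i _ j _ h => disj i j h)]
  apply Finset.sum_le_sum_of_subset_of_nonneg
  · intro e he
    obtain ⟨i, _, hi⟩ := Finset.mem_biUnion.1 he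
    exact sub i hi
  · intro e _ _; exact cr_nonneg _ _

theorem dS_ge_two {ends : E → V × V} {T : Finset E} {A : Finset V} {e1 e2 : E} (h12 : e1 ≠ e2)
    (h1 : e1 ∈ T) (h2 : e2 ∈ T) (c1 : cr A (ends e1) = 1) (c2 : cr A (ends e2) = 1) :
    2 ≤ dS ends T A := by
  unfold dS
  rw [← Finset.add_sum_erase T _ h1,
    ← Finset.add_sum_erase (T.erase e1) _ (Finset.mem_erase.2 ⟨h12.symm, h2⟩), c1, c2]
  have : 0 ≤ ∑ e ∈ (T.erase e1).erase e2, cr A (ends e) :=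
    Finset.sum_nonneg fun _ _ => cr_nonneg _ _
  omega

theorem dS_ge_one {ends : E → V × V} {T : Finset E} {A : Finset V} {e1 : E} 
    (h1 : e1 ∈ T) (c1 : cr A (ends e1) = 1) : 1 ≤ dS ends T A := by
  unfold dS
  rw [← Finset.add_sum_erase T _ h1, c1]
  have : 0 ≤ ∑ e ∈ T.erase e1, cr A (ends e) :=
    Finset.sum_nonneg fun _ _ => cr_nonneg _ _
  omega

theorem TB.lift {k : ℤ} {ends : E → V × V} {S : Finset E} {W : Finset V}
    {c : V → ℤ} {T : ι → Finset E} (H : TB k ends S W c T) {e1 f : E} {u1 v w : V} (hef : e1 ≠ f)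
    (h1 : e1 ∈ S) (hf : f ∈ S) (j1 : Joins (ends e1) u1 v) (jf : Joins (ends f) v w) :
    TB k (Function.update ends e1 (u1, w)) (S.erase f) W c (fun i => (T i).erase f) := by
  constructor
  · exact mem_lift H.mem (j1.mem H.mem h1).1 (jf.mem H.mem hf).2
  · intro A hA
    have := H.par A hA
    have := cr_tri A u1 v w
    rw [dS_lift hef h1 hf j1 jf]; omega
  · exact H.sum
  · intro i; exact Finset.erase_subset_erase _ (H.sub i)
  · intro i j hij
    exact (H.disj i j hij).mono (Finset.erase_subset _ _) (Finset.erase_subset _ _)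

theorem Cn.congr {ends ends' : E → V × V} {T T' : Finset E} {W : Finset V} (h : Cn ends T W)
    (hT : T ⊆ T') (he : ∀ e ∈ T, ends' e = ends e) : Cn ends' T' W := by
  intro A h1 h2 h3
  obtain ⟨e, h, hc⟩ := h A h1 h2 h3
  exact ⟨e, hT h, by rw [he e h]; exact hc⟩

theorem Cn'.congr {ends ends' : E → V × V} {T T' : Finset E} {W : Finset V} {v : V}
    (h : Cn' ends T W v)
    (hT : T ⊆ T') (he : ∀ e ∈ T, ends' e = ends e) : Cn' ends' T' W v := by
  intro A h1 h2 h3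
  obtain ⟨e, h, hc⟩ := h A h1 h2 h3
  exact ⟨e, hT h, by rw [he e h]; exact hc⟩

/-- the splitting lemma -/
theorem split {k : ℤ} (hk : 2 ≤ k) {W : Finset V} (IH : IHT V E ι k W.card) {v : V} (hv : v ∈ W)
    (hW : {v} ≠ W) (c : V → ℤ) (m : ℕ) :
    ∀ (ends : E → V × V) (S : Finset E) (T : ι → Finset E) (J : Finset ι), S.card = m →
      TB k ends S W c T → (∀ i ∈ J, Cn ends (T i) W) → (∀ i ∉ J, Cn' ends (T i) W v) →
      dS ends S {v} ≤ 2 * J.card - (k - 1) → Sol k ends S W c := by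
  induction m using Nat.strong_induction_on with
  | _ m ih =>
  intro ends S T0 J hm H0 hJ0 hJ0' hD
  -- minimal trees
  have hmin : ∃ T : ι → Finset E, (∀ i, T i ⊆ T0 i) ∧ (∀ i ∈ J, Cn ends (T i) W) ∧
      (∀ i ∉ J, T i = T0 i) ∧ (∀ i ∈ J, ∀ e ∈ T i, ¬ Cn ends ((T i).erase e) W) := by
    have : ∀ i, ∃ M ⊆ T0 i, (i ∈ J → Cn ends M W ∧ ∀ e ∈ M, ¬ Cn ends (M.erase e) W) ∧
        (i ∉ J → M = T0 i) := by
      intro i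
      by_cases hi : i ∈ J
      · obtain ⟨M, h1, h2⟩ := exists_min (hJ0 i hi)
        exact ⟨M, h1, fun _ => h2, fun h => absurd hi h⟩
      · exact ⟨T0 i, Finset.Subset.refl _, fun h => absurd h hi, fun _ => rfl⟩
    choose T h1 h2 h3 using this
    exact ⟨T, h1, fun i hi => (h2 i hi).1, h3, fun i hi => (h2 i hi).2⟩
  obtain ⟨T, hTT, hJ, hTe, hTmin⟩ := hmin
  have H : TB k ends S W c T :=
    { H0 with
      sub := fun i => (hTT i).trans (H0.sub i)
      disj := fun i j hij => (H0.disj i j hij).mono (hTT i) (hTT j) }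
  have hJ' : ∀ i ∉ J, Cn' ends (T i) W v := fun i hi => by rw [hTe i hi]; exact hJ0' i hi
  have memT : ∀ i, ∀ e ∈ T i, (ends e).1 ∈ W ∧ (ends e).2 ∈ W := fun i e he =>
    H.mem e (H.sub i he)
  have hs : ({v} : Finset V) ⊆ W := Finset.singleton_subset_iff.2 hv
  have hsumle := sum_trees_le (ends := ends) J H.sub H.disj {v}
  by_cases c1 : ∃ i ∈ J, ∃ e1 ∈ T i, ∃ e2 ∈ T i, e1 ≠ e2 ∧ cr {v} (ends e1) = 1 ∧
      cr {v} (ends e2) = 1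
  · obtain ⟨i, hi, e1, h1, e2, h2, h12, cr1, cr2⟩ := c1
    -- a tree with exactly one edge at v
    have hl : ∃ l ∈ J, dS ends (T l) {v} < 2 := by
      by_contra hc
      push Not at hc
      have := Finset.card_nsmul_le_sum J _ 2 hc
      rw [nsmul_eq_mul] at this
      omega
    obtain ⟨l, hlJ, hl2⟩ := hl
    have hil : i ≠ l := by
      rintro rfl
      have := dS_ge_two h12 h1 h2 cr1 cr2
      omega
    obtain ⟨f, hf, crf⟩ := hJ l hlJ {v} hs (by simp) hW
    have hfu : ∀ e ∈ T l, cr {v} (ends e) = 1 → e = f := by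
      intro e he hc
      by_contra hne
      have := dS_ge_two hne he hf hc crf
      omega
    obtain ⟨w, hwv, jf⟩ := joins_of_cr crf
    obtain ⟨u1, hu1, j1⟩ := joins_of_cr cr1
    obtain ⟨u2, hu2, j2⟩ := joins_of_cr cr2
    have hwW := (jf.mem H.mem (H.sub l hf)).2
    obtain ⟨A1, s1, u1A, v1, q1⟩ := bridge (memT i) (hJ i hi) h1 (hTmin i hi e1 h1) j1.symm
    obtain ⟨A2, s2, u2A, v2, q2⟩ := bridge (memT i) (hJ i hi) h2 (hTmin i hi e2 h2) j2.symm
    have key : ∃ e ∈ T i, ∃ u A, u ≠ v ∧ Joins (ends e) u v ∧ A ⊆ W ∧ u ∈ A ∧ v ∉ A ∧ w ∉ A ∧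
        ∀ e' ∈ T i, cr A (ends e') = 1 → e' = e := by
      rcases two_bridges (w := w) (hJ i hi) hv h12 h1 h2 j1.symm j2.symm s1 v1 v2 q1 q2 with h | h
      · exact ⟨e1, h1, u1, A1, hu1, j1.symm, s1, u1A, v1, h, q1⟩
      · exact ⟨e2, h2, u2, A2, hu2, j2.symm, s2, u2A, v2, h, q2⟩
    obtain ⟨e, he, u, A, huv, j, sA, uA, vA, wA, q⟩ := key
    have hnf : ∀ a ≠ l, f ∉ T a := fun a ha hfa =>
      Finset.disjoint_left.1 (H.disj a l ha) hfa hf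
    have hne1 : ∀ a ≠ i, e ∉ T a := fun a ha hea =>
      Finset.disjoint_left.1 (H.disj a i ha) hea he
    have hef : e ≠ f := fun h => hnf i hil (h ▸ he)
    have heS := H.sub i he
    have hfS := H.sub l hf
    apply lift_sol hef heS hfS j jf
    have hup : ∀ a ≠ i, ∀ e' ∈ T a, Function.update ends e (u, w) e' = ends e' := by
      intro a ha e' he'
      apply Function.update_of_ne
      rintro rfl
      exact hne1 a ha he'
    have hcard : 0 < S.card := Finset.card_pos.2 ⟨f, hfS⟩
    have hJc : 0 < J.card := Finset.card_pos.2 ⟨l, hlJ⟩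
    refine ih (S.erase f).card (by rw [Finset.card_erase_of_mem hfS]; omega) _ _
      (fun i => (T i).erase f) (J.erase l) rfl (H.lift hef heS hfS j jf) ?_ ?_ ?_
    · intro a ha
      rw [Finset.mem_erase] at ha
      rw [Finset.erase_eq_of_notMem (hnf a ha.1)]
      by_cases hai : a = i
      · subst hai
        exact swing (hJ a hi) he j sA uA vA hwW wA q
      · exact (hJ a ha.2).congr (Finset.Subset.refl _) (hup a hai)
    · intro a ha
      by_cases hal : a = l
      · subst hal
        exact (cn_unique (memT a) (hJ a hlJ) hv jf hfu).congr (Finset.Subset.refl _)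
          (fun e' he' => hup a hil.symm e' (Finset.mem_of_mem_erase he'))
      · have haJ : a ∉ J := fun h => ha (Finset.mem_erase.2 ⟨hal, h⟩)
        have hai : a ≠ i := fun h => haJ (h ▸ hi)
        rw [Finset.erase_eq_of_notMem (hnf a hal)]
        exact (hJ' a haJ).congr (Finset.Subset.refl _) (hup a hai)
    · rw [dS_lift hef heS hfS j jf, Finset.card_erase_of_mem hlJ]
      have a1 : cr {v} (u, v) = 1 := by simp [cr, huv]
      have a2 : cr {v} (v, w) = 1 := by simp [cr, hwv]
      have a3 : cr {v} (u, w) = 0 := by simp [cr, huv, hwv]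
      rw [a1, a2, a3]
      omega
  · push Not at c1
    have hge : ∀ i ∈ J, 1 ≤ dS ends (T i) {v} := by
      intro i hi
      obtain ⟨f, hf, crf⟩ := hJ i hi {v} hs (by simp) hW
      exact dS_ge_one hf crf
    have hJle := Finset.card_nsmul_le_sum J _ 1 hge
    rw [nsmul_eq_mul] at hJle
    have hpar := H.par {v} hs
    rw [Finset.sum_singleton] at hpar
    have p2 := nrm_par hk (c v)
    have p3 := nrm_le hk (c v)
    refine del_vertex hk IH H hv (by omega) ?_
    intro i
    by_cases hi : i ∈ J
    · obtain ⟨f, hf, crf⟩ := hJ i hi {v} hs (by simp) hW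
      obtain ⟨w, hwv, jf⟩ := joins_of_cr crf
      have hfu : ∀ e ∈ T i, cr {v} (ends e) = 1 → e = f := by
        intro e he hc
        by_contra hne
        exact c1 i hi e he f hf hne hc crf
      exact (cn_unique (memT i) (hJ i hi) hv jf hfu).mono (Finset.erase_subset _ _)
    · exact hJ' i hi

theorem F_zero (k : ℤ) (ends : E → V × V) (S : Finset E) (c : V → ℤ) (A : Finset V) :
    F k ends S c (fun _ => 0) (fun _ => 0) A
      = dS ends S A - nrm k (∑ v ∈ A, c v) - (2 * k - 2) := by
  unfold F
  simp

theorem tree_step [Fintype ι] {k : ℤ} (hk : 2 ≤ k) (hι : (Fintype.card ι : ℤ) = 2 * k - 2)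
    {ends : E → V × V} {S : Finset E} {W : Finset V}
    {c : V → ℤ} {T : ι → Finset E} (IH : IHT V E ι k W.card) (H : TB k ends S W c T)
    (hT : ∀ i, Cn ends (T i) W) : Sol k ends S W c := by
  classical
  by_cases cA : ∃ A ⊆ W, A.Nonempty ∧ A ≠ W ∧ F k ends S c (fun _ => 0) (fun _ => 0) A < 0
  · obtain ⟨A, hA, hmin⟩ := Finset.exists_min_image (W.powerset.filter fun A =>
      A.Nonempty ∧ A ≠ W ∧ F k ends S c (fun _ => 0) (fun _ => 0) A < 0) Finset.card (by
        obtain ⟨A, h1, h2⟩ := cA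
        exact ⟨A, Finset.mem_filter.2 ⟨Finset.mem_powerset.2 h1, h2⟩⟩)
    rw [Finset.mem_filter, Finset.mem_powerset] at hA
    obtain ⟨hAW, hne, hAne, hF⟩ := hA
    rcases Nat.lt_or_ge A.card 2 with hc | hc
    · have : A.card = 1 := by have := hne.card_pos; omega
      obtain ⟨v, rfl⟩ := Finset.card_eq_one.1 this
      have hv : v ∈ W := hAW (by simp)
      refine split hk IH hv hAne c S.card ends S T Finset.univ rfl H (fun i _ => hT i)
        (fun i hi => absurd (Finset.mem_univ i) hi) ?_
      rw [F_zero] at hF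
      have := nrm_le hk (∑ x ∈ {v}, c x)
      rw [Finset.card_univ, hι]
      omega
    · obtain ⟨a, ha⟩ := hne
      refine contract_step H.mem A a ha hAW ?_ ?_
      · refine IH _ S _ _ T (card_col_lt hAW hc ha) ?_ ?_
        · constructor
          · intro e he
            exact ⟨Finset.mem_image_of_mem _ (H.mem e he).1,
              Finset.mem_image_of_mem _ (H.mem e he).2⟩
          · intro B hB
            rw [dS_push _ _ _ W _ H.mem, sum_push]
            exact H.par _ (Finset.filter_subset _ _)
          · rw [sum_push, filter_image]; exact H.sum
          · exact H.sub
          · exact H.disj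
        · intro i B hB hne hBW
          have him := image_filter (col A a) W B hB
          obtain ⟨e, he, hcr⟩ := hT i (W.filter (col A a · ∈ B)) (Finset.filter_subset _ _)
            (by rw [← Finset.image_nonempty (f := col A a), him]; exact hne)
            (by intro h; rw [h] at him; exact hBW him.symm)
          refine ⟨e, he, ?_⟩
          have hm := H.mem e (H.sub i he)
          rw [cr_eq_abs, ← ind_push _ W B hm.1, ← ind_push _ W B hm.2] at hcr
          rw [cr_eq_abs]
          exact hcr
      · intro ε hε hsum
        obtain ⟨o', i', H'⟩ := hyp_restrict (U := ∅) (o := fun _ => 0) (i := fun _ => 0) hk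
          (fun v hv => le_rfl)
          (fun v hv => le_rfl) (fun B hB => H.par B (hB.trans hAW)) hF.le
          (by simp) (by simp) (by simp)
          (fun B hB hne hBA _ => by
            by_contra hlt
            push Not at hlt
            have := hmin B (by
              rw [Finset.mem_filter, Finset.mem_powerset]
              exact ⟨hB.trans hAW, hne,
                fun h => hAne (Finset.Subset.antisymm hAW (h ▸ hB)), hlt⟩)
            exact hBA (Finset.eq_of_subset_of_card_le hB this)) ε hε hsum
        exact thmL H'
  · push Not at cA
    refine thmL (o := fun _ => 0) (i := fun _ => 0) (U := ∅)
      { hk := hk, mem := H.mem, onn := fun _ _ => le_rfl, inn := fun _ _ => le_rfl, par := H.par,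
        sum := H.sum, root := ?_, Usub := by simp, Ucard := by simp, Uz := by simp, 
        cut := fun A h1 h2 h3 _ => cA A h1 h2 h3 }
    rw [F_zero, dS_W H.mem]
    have := nrm_nonneg hk (∑ v ∈ W, c v)
    omega

theorem tree_thm [Fintype ι] {k : ℤ} (hk : 2 ≤ k) (hι : (Fintype.card ι : ℤ) = 2 * k - 2)
    {ends : E → V × V} {S : Finset E} {W : Finset V}
    {c : V → ℤ} {T : ι → Finset E} (H : TB k ends S W c T)
    (hT : ∀ i, Cn ends (T i) W) : Sol k ends S W c := by
  have : ∀ n, IHT V E ι k n := by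
    intro n
    induction n with
    | zero => intro ends S W c T h; omega
    | succ n ih =>
      intro ends S W c T h H hT
      refine tree_step hk hι ?_ H hT
      intro ends' S' W' c' T' h' H' hT'
      exact ih ends' S' W' c' T' (by omega) H' hT'
  exact this (W.card + 1) ends S W c T (by omega) H hT

end

section Konig

theorem card_fib {X E : Type*} [DecidableEq X] [DecidableEq E] {f : E → X} {S : Finset E} {k : ℕ}
    (hf : ∀ x, (S.filter (f · = x)).card = k) (A : Finset X) :
    (S.filter (f · ∈ A)).card = k * A.card := by
  have h0 := Finset.card_eq_sum_card_fiberwise (s := S.filter (f · ∈ A)) (f := f) (t := A)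
    (fun e he => (Finset.mem_filter.1 he).2)
  rw [h0]
  rw [Finset.sum_congr rfl (g := fun _ => k)]
  · simp [mul_comm]
  · intro x hx
    rw [← hf x, Finset.filter_filter]
    congr 1
    ext e
    simp only [Finset.mem_filter]
    constructor
    · rintro ⟨h1, h2, h3⟩; exact ⟨h1, h3⟩
    · rintro ⟨h1, h3⟩; exact ⟨h1, h3 ▸ hx, h3⟩

theorem konig_reg {X Y E : Type*} [Fintype X] [Fintype Y] [DecidableEq X] [DecidableEq Y]
    [DecidableEq E] (f : E → X) (g : E → Y) (k : ℕ) : ∀ S : Finset E,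
    (∀ x, (S.filter (f · = x)).card = k) → (∀ y, (S.filter (g · = y)).card = k) →
    ∃ col : E → ℕ, (∀ e ∈ S, col e < k) ∧
      ∀ e ∈ S, ∀ e' ∈ S, (f e = f e' ∨ g e = g e') → col e = col e' → e = e' := by
  induction k with
  | zero =>
    intro S hf hg
    have : S = ∅ := by
      by_contra h
      obtain ⟨e, he⟩ := Finset.nonempty_iff_ne_empty.2 h
      have := hf (f e)
      rw [Finset.card_eq_zero] at this
      have h2 : e ∈ S.filter (f · = f e) := by simp [he]
      rw [this] at h2; simp at h2
    subst this
    exact ⟨fun _ => 0, by simp, by simp⟩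
  | succ k ih =>
    intro S hf hg
    have hall := (Finset.all_card_le_biUnion_card_iff_exists_injective
      (fun x => (S.filter (f · = x)).image g)).1 (by
        intro A
        have h1 := card_fib hf A
        have h2 := card_fib hg (A.biUnion fun x => (S.filter (f · = x)).image g)
        have h3 : (S.filter (f · ∈ A)).card ≤
            (S.filter (g · ∈ A.biUnion fun x => (S.filter (f · = x)).image g)).card := by
          apply Finset.card_le_card
          intro e he
          rw [Finset.mem_filter] at he ⊢
          refine ⟨he.1, ?_⟩
          rw [Finset.mem_biUnion]
          exact ⟨f e, he.2, Finset.mem_image_of_mem _ (by simp [he.1])⟩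
        rw [h1, h2] at h3
        exact Nat.le_of_mul_le_mul_left h3 (Nat.succ_pos k))
    obtain ⟨φ, hφ, hφm⟩ := hall
    have hcard : Fintype.card X = Fintype.card Y := by
      have h1 := card_fib hf univ
      have h2 := card_fib hg univ
      simp only [Finset.mem_univ, Finset.filter_true] at h1 h2
      rw [h1] at h2
      exact Nat.eq_of_mul_eq_mul_left (Nat.succ_pos k) h2
    have hbij : Function.Bijective φ := (Fintype.bijective_iff_injective_and_card φ).2 ⟨hφ, hcard⟩
    have : ∀ x, ∃ e ∈ S, f e = x ∧ g e = φ x := by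
      intro x
      have := hφm x
      rw [Finset.mem_image] at this
      obtain ⟨e, he, h⟩ := this
      rw [Finset.mem_filter] at he
      exact ⟨e, he.1, he.2, h⟩
    choose m hmS hmf hmg using this
    set M : Finset E := univ.image m with hM
    have hMS : M ⊆ S := by
      intro e he
      rw [hM, Finset.mem_image] at he
      obtain ⟨x, -, rfl⟩ := he
      exact hmS x
    have hMf : ∀ e ∈ M, e = m (f e) := by
      intro e he
      rw [hM, Finset.mem_image] at he
      obtain ⟨x, -, rfl⟩ := he
      rw [hmf]
    have h1 : ∀ x, ((S \ M).filter (f · = x)).card = k := by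
      intro x
      have : (S \ M).filter (f · = x) = (S.filter (f · = x)).erase (m x) := by
        ext e
        simp only [Finset.mem_filter, Finset.mem_sdiff, Finset.mem_erase]
        constructor
        · rintro ⟨⟨a, b⟩, c⟩
          refine ⟨?_, a, c⟩
          rintro rfl
          exact b (by simp [hM])
        · rintro ⟨a, b, c⟩
          refine ⟨⟨b, fun h => a ?_⟩, c⟩
          rw [hMf e h, c]
      rw [this, Finset.card_erase_of_mem (by simp [hmS, hmf]), hf]; rfl
    have h2 : ∀ y, ((S \ M).filter (g · = y)).card = k := by
      intro y
      obtain ⟨x, rfl⟩ := hbij.2 y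
      have : (S \ M).filter (g · = φ x) = (S.filter (g · = φ x)).erase (m x) := by
        ext e
        simp only [Finset.mem_filter, Finset.mem_sdiff, Finset.mem_erase]
        constructor
        · rintro ⟨⟨a, b⟩, c⟩
          refine ⟨?_, a, c⟩
          rintro rfl
          exact b (by simp [hM])
        · rintro ⟨a, b, c⟩
          refine ⟨⟨b, fun h => a ?_⟩, c⟩
          have h3 := hMf e h
          rw [h3, hmg] at c
          rw [h3, hφ c]
      rw [this, Finset.card_erase_of_mem (by simp [hmS, hmg]), hg]; rfl
    obtain ⟨col, hc1, hc2⟩ := ih (S \ M) h1 h2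
    refine ⟨fun e => if e ∈ M then k else col e, ?_, ?_⟩
    · intro e he
      by_cases h : e ∈ M
      · simp [h]
      · simp only [h, if_false]
        have := hc1 e (by simp [he, h])
        omega
    · intro e he e' he' hor heq
      by_cases h : e ∈ M <;> by_cases h' : e' ∈ M
      · rcases hor with q | q
        · rw [hMf e h, hMf e' h', q]
        · rw [hMf e h, hMf e' h', hmg, hmg] at q
          rw [hMf e h, hMf e' h', hφ q]
      · simp only [h, h', if_true, if_false] at heq
        have := hc1 e' (by simp [he', h'])
        omega
      · simp only [h, h', if_true, if_false] at heq
        have := hc1 e (by simp [he, h])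
        omega
      · simp only [h, h', if_false] at heq
        exact hc2 e (by simp [he, h]) e' (by simp [he', h']) hor heq

theorem konig_le {X Y E : Type*} [Fintype X] [Fintype Y] [Fintype E] [DecidableEq X] [DecidableEq Y]
    [DecidableEq E] (f : E → X) (g : E → Y) (k : ℕ) (hk : 0 < k)
    (hf : ∀ x, (univ.filter (f · = x)).card = k) (hg : ∀ y, (univ.filter (g · = y)).card ≤ k) :
    ∃ col : E → ℕ, (∀ e, col e < k) ∧
      ∀ e e', (f e = f e' ∨ g e = g e') → col e = col e' → e = e' := by
  have hE : Fintype.card E = k * Fintype.card X := by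
    have := card_fib hf univ
    simpa using this
  have hsum : ∑ y, (univ.filter (g · = y)).card = Fintype.card E := by
    have := Finset.card_eq_sum_card_fiberwise (f := g) (s := univ) (t := univ) (by simp)
    rw [← this]; rfl
  let D := Σ y : Y, Fin (k - (univ.filter (g · = y)).card)
  have hD1 : Fintype.card D + Fintype.card E = k * Fintype.card Y := by
    simp only [D, Fintype.card_sigma, Fintype.card_fin]
    rw [← hsum, ← Finset.sum_add_distrib, Finset.sum_congr rfl (g := fun _ => k)]
    · simp [mul_comm]
    · intro y _
      have := hg y
      omega
  have hXY : Fintype.card X ≤ Fintype.card Y := by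
    rw [hE] at hD1
    have : k * Fintype.card X ≤ k * Fintype.card Y := by omega
    exact Nat.le_of_mul_le_mul_left this hk
  obtain ⟨r, hr⟩ := Nat.exists_eq_add_of_le hXY
  have hD : Fintype.card D = Fintype.card (Fin r × Fin k) := by
    rw [hE, hr, mul_add] at hD1
    simp only [Fintype.card_prod, Fintype.card_fin]
    rw [mul_comm r k]; omega
  have eqv : D ≃ Fin r × Fin k := Fintype.equivOfCardEq hD
  obtain ⟨col, h1, h2⟩ := konig_reg (E := E ⊕ D) (X := X ⊕ Fin r) (Y := Y)
    (Sum.elim (fun e => Sum.inl (f e)) (fun d => Sum.inr (eqv d).1))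
    (Sum.elim g (fun d => d.1)) k univ (by
      rintro (x | j)
      · refine Eq.trans ?_ (hf x)
        rw [← Finset.card_map (Function.Embedding.inl (α := E) (β := D))]
        congr 1
        ext (e | d) <;> simp
      · have : (univ : Finset (Fin k)).card = k := by simp
        refine Eq.trans (Eq.symm ?_) this
        apply Finset.card_bij (fun t _ => Sum.inr (eqv.symm (j, t)))
        · intro t _; simp
        · intro t _ t' _ h
          simpa using h
        · rintro (e | d) hd
          · simp at hd
          · simp at hd
            refine ⟨(eqv d).2, by simp, ?_⟩
            rw [← hd]; simp) (by
      intro y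
      have h3 : (univ.filter (g · = y)).card + (k - (univ.filter (g · = y)).card) = k := by
        have := hg y; omega
      refine Eq.trans ?_ h3
      have : (univ.filter fun z : E ⊕ D => Sum.elim g (fun d => d.1) z = y) =
        (univ.filter (g · = y)).disjSum (univ.filter fun d : D => d.1 = y) := by
        ext (e | d) <;> simp
      rw [this, Finset.card_disjSum]
      congr 1
      have : (univ : Finset (Fin (k - (univ.filter (g · = y)).card))).card
        = k - (univ.filter (g · = y)).card := by simp
      refine Eq.trans (Eq.symm ?_) this
      apply Finset.card_bij (fun t _ => (⟨y, t⟩ : D))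
      · intro t _; simp
      · intro t _ t' _ h
        simpa using h
      · rintro ⟨y', t⟩ hd
        simp at hd
        subst hd
        exact ⟨t, by simp, rfl⟩)
  refine ⟨fun e => col (Sum.inl e), fun e => h1 _ (by simp), fun e e' hor heq => ?_⟩
  have := h2 (Sum.inl e) (by simp) (Sum.inl e') (by simp) (by simpa using hor) heq
  exact Sum.inl_injective this

/-- Group a finite set into consecutive blocks of size `k`. -/
theorem grp {E : Type*} [DecidableEq E] (s : Finset E) (k : ℕ) (hk : 0 < k) :
    ∃ g : E → ℕ, ∀ j, (s.filter (g · = j)).card = min k (s.card - j * k) := by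
  refine ⟨fun e => if h : e ∈ s then (s.equivFin ⟨e, h⟩ : ℕ) / k else 0, fun j => ?_⟩
  have : min k (s.card - j * k) = (Finset.Ico (j * k) (min ((j + 1) * k) s.card)).card := by
    rw [Nat.card_Ico, add_mul, one_mul]; omega
  rw [this]
  apply Finset.card_bij (fun e _ => if h : e ∈ s then (s.equivFin ⟨e, h⟩ : ℕ) else 0)
  · intro e he
    rw [Finset.mem_filter] at he
    obtain ⟨h, h2⟩ := he
    simp only [h, dif_pos] at h2 ⊢
    rw [Finset.mem_Ico, lt_min_iff]
    refine ⟨?_, ?_, (s.equivFin ⟨e, h⟩).2⟩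
    · rw [← h2]; exact Nat.div_mul_le_self _ _
    · rw [← h2]; rw [add_mul, one_mul]; exact Nat.lt_div_mul_add hk
  · intro e he e' he' h
    have h1 := (Finset.mem_filter.1 he).1
    have h2 := (Finset.mem_filter.1 he').1
    simp only [h1, h2, dif_pos] at h
    have := s.equivFin.injective (Fin.ext h)
    simpa using this
  · intro t ht
    rw [Finset.mem_Ico, lt_min_iff] at ht
    refine ⟨(s.equivFin.symm ⟨t, ht.2.2⟩ : E), ?_, ?_⟩
    · rw [Finset.mem_filter]
      refine ⟨Finset.coe_mem _, ?_⟩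
      simp only [Finset.coe_mem, dif_pos, Subtype.coe_eta, Equiv.apply_symm_apply]
      apply Nat.div_eq_of_lt_le <;> linarith [ht.1, ht.2.1]
    · simp

/-- Colour counts in a set grouped in blocks. -/
theorem grp_count {E : Type*} [DecidableEq E] (s : Finset E) (k : ℕ) (hk : 0 < k) (g col : E → ℕ)
    (hg : ∀ j, (s.filter (g · = j)).card = min k (s.card - j * k))
    (hc : ∀ e, col e < k)
    (hi : ∀ e ∈ s, ∀ e' ∈ s, g e = g e' → col e = col e' → e = e') (i : ℕ) (hik : i < k) :
    |(k : ℤ) * (s.filter (col · = i)).card - s.card| < k := by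
  set n := s.card with hn
  set q := n / k with hq
  have hqr : k * q + n % k = n := Nat.div_add_mod n k
  have hr : n % k < k := Nat.mod_lt _ hk
  have hgq : ∀ e ∈ s, g e ≤ q := by
    intro e he
    by_contra h
    have h1 := hg (g e)
    have h2 : 0 < (s.filter (g · = g e)).card :=
      Finset.card_pos.2 ⟨e, by simp [he]⟩
    have h3 : (q + 1) * k ≤ g e * k := Nat.mul_le_mul_right _ (by omega)
    have h4 : (q + 1) * k = k * q + k := by ring
    omega
  have hle : (s.filter (col · = i)).card ≤ ((s.filter (col · = i)).image g).card := by
    rw [Finset.card_image_of_injOn]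
    intro e he e' he' h
    have h1 := Finset.mem_filter.1 he
    have h2 := Finset.mem_filter.1 he'
    exact hi e h1.1 e' h2.1 h (h1.2.trans h2.2.symm)
  have hlow : (Finset.range q) ⊆ (s.filter (col · = i)).image g := by
    intro j hj
    rw [Finset.mem_range] at hj
    have h3 : (j + 1) * k ≤ q * k := Nat.mul_le_mul_right _ (by omega)
    have h4 : (j + 1) * k = j * k + k := by ring
    have h5 : q * k = k * q := by ring
    have h6 : (s.filter (g · = j)).card = k := by rw [hg j]; omega
    have h7 : (s.filter (g · = j)).image col = Finset.range k := by
      apply Finset.eq_of_subset_of_card_le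
      · intro c hc'
        rw [Finset.mem_image] at hc'
        obtain ⟨e, -, rfl⟩ := hc'
        simpa using hc e
      · rw [Finset.card_range, Finset.card_image_of_injOn, h6]
        intro e he e' he' h
        have h1 := Finset.mem_filter.1 he
        have h2 := Finset.mem_filter.1 he'
        exact hi e h1.1 e' h2.1 (h1.2.trans h2.2.symm) h
    have h8 : i ∈ (s.filter (g · = j)).image col := by rw [h7]; simpa using hik
    rw [Finset.mem_image] at h8
    obtain ⟨e, he, h9⟩ := h8
    rw [Finset.mem_filter] at he
    rw [Finset.mem_image]
    exact ⟨e, by simp [he.1, h9], he.2⟩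
  have hup : (s.filter (col · = i)).image g ⊆ Finset.range (if n % k = 0 then q else q + 1) := by
    intro j hj
    rw [Finset.mem_image] at hj
    obtain ⟨e, he, rfl⟩ := hj
    have he' := (Finset.mem_filter.1 he).1
    have h0 := hgq e he'
    rw [Finset.mem_range]
    split_ifs with h
    · rcases h0.lt_or_eq with h1 | h1
      · exact h1
      · exfalso
        have h2 := hg (g e)
        have h3 : 0 < (s.filter (g · = g e)).card :=
          Finset.card_pos.2 ⟨e, by simp [he']⟩
        have h4 : q * k = k * q := by ring
        rw [h1] at h2 h3
        omega
    · omega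
  have c1 := Finset.card_le_card hlow
  have c2 := Finset.card_le_card hup
  have c3 : ((s.filter (col · = i)).image g).card ≤ (s.filter (col · = i)).card :=
    Finset.card_image_le
  rw [Finset.card_range] at c1 c2
  set N := (s.filter (col · = i)).card
  have d1 : q ≤ N := c1.trans c3
  have d2 : N ≤ if n % k = 0 then q else q + 1 := hle.trans c2
  have e1 : (k : ℤ) * q + (n % k : ℕ) = n := by exact_mod_cast hqr
  have e2 : ((n % k : ℕ) : ℤ) < k := by exact_mod_cast hr
  have e3 : (0 : ℤ) ≤ ((n % k : ℕ) : ℤ) := by positivity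
  have hk' : (0 : ℤ) < k := by exact_mod_cast hk
  rw [abs_lt]
  split_ifs at d2 with h
  · have : N = q := by omega
    rw [this]
    have : ((n % k : ℕ) : ℤ) = 0 := by exact_mod_cast h
    constructor <;> linarith
  · have h0 : (0 : ℤ) < ((n % k : ℕ) : ℤ) := by
      have : 0 < n % k := Nat.pos_of_ne_zero h
      exact_mod_cast this
    have hN : N = q ∨ N = q + 1 := by omega
    rcases hN with h | h <;> rw [h] <;> push_cast <;> constructor <;> linarith

theorem equit {V E : Type*} [Fintype V] [Fintype E] [DecidableEq V] [DecidableEq E]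
    (x y : E → V) (k : ℕ) (hk : 0 < k) (hx : ∀ v, k ∣ (univ.filter (x · = v)).card) :
    ∃ col : E → ℕ, (∀ e, col e < k) ∧ ∀ v i, i < k →
      k * ((univ.filter (x · = v)).filter (col · = i)).card = (univ.filter (x · = v)).card ∧
      |(k : ℤ) * ((univ.filter (y · = v)).filter (col · = i)).card
        - (univ.filter (y · = v)).card| < k := by
  choose gx hgx using fun v => grp (univ.filter (x · = v)) k hk
  choose gy hgy using fun v => grp (univ.filter (y · = v)) k hk
  let f0 : E → V × ℕ := fun e => (x e, gx (x e) e)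
  let g0 : E → V × ℕ := fun e => (y e, gy (y e) e)
  have hf0 : ∀ v j, (univ.filter (f0 · = (v, j))).card =
      min k ((univ.filter (x · = v)).card - j * k) := by
    intro v j
    rw [← hgx v j, Finset.filter_filter]
    congr 1
    ext e
    simp only [f0, Finset.mem_filter, Finset.mem_univ, true_and, Prod.mk.injEq]
    constructor <;> rintro ⟨h1, h2⟩ <;> subst h1 <;> exact ⟨rfl, h2⟩
  have hg0 : ∀ v j, (univ.filter (g0 · = (v, j))).card =
      min k ((univ.filter (y · = v)).card - j * k) := by
    intro v j
    rw [← hgy v j, Finset.filter_filter]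
    congr 1
    ext e
    simp only [g0, Finset.mem_filter, Finset.mem_univ, true_and, Prod.mk.injEq]
    constructor <;> rintro ⟨h1, h2⟩ <;> subst h1 <;> exact ⟨rfl, h2⟩
  let X := {p : V × ℕ // p ∈ univ.image f0}
  let Y := {p : V × ℕ // p ∈ univ.image g0}
  have : Finite X := Finset.finite_toSet (univ.image f0)
  have : Finite Y := Finset.finite_toSet (univ.image g0)
  have : Fintype X := Fintype.ofFinite _
  have : Fintype Y := Fintype.ofFinite _
  obtain ⟨col, h1, h2⟩ := konig_le (X := X) (Y := Y)
    (fun e => ⟨f0 e, Finset.mem_image_of_mem _ (Finset.mem_univ _)⟩)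
    (fun e => ⟨g0 e, Finset.mem_image_of_mem _ (Finset.mem_univ _)⟩) k hk (by
      rintro ⟨⟨v, j⟩, hp⟩
      refine Eq.trans (b := (univ.filter (f0 · = (v, j))).card)
        (congrArg _ (Finset.filter_congr fun e _ => Subtype.ext_iff)) ?_
      have hpos : 0 < (univ.filter (f0 · = (v, j))).card := by
        rw [Finset.mem_image] at hp
        obtain ⟨e, -, he⟩ := hp
        exact Finset.card_pos.2 ⟨e, by simp [he]⟩
      rw [hf0] at hpos ⊢
      obtain ⟨m, hm⟩ := hx v
      rw [hm] at hpos ⊢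
      have hjm : j < m := by
        by_contra h
        have : k * m ≤ k * j := Nat.mul_le_mul_left _ (by omega)
        have h4 : j * k = k * j := by ring
        omega
      have : k * (j + 1) ≤ k * m := Nat.mul_le_mul_left _ hjm
      have h4 : k * (j + 1) = j * k + k := by ring
      omega) (by
      rintro ⟨⟨v, j⟩, hp⟩
      refine le_of_eq_of_le (b := (univ.filter (g0 · = (v, j))).card)
        (congrArg _ (Finset.filter_congr fun e _ => Subtype.ext_iff)) ?_
      rw [hg0]
      exact min_le_left _ _)
  refine ⟨col, h1, fun v i hi => ⟨?_, ?_⟩⟩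
  · have := grp_count _ k hk _ col (hgx v) h1 (by
      intro e he e' he' h h'
      simp only [Finset.mem_filter, Finset.mem_univ, true_and] at he he'
      refine h2 e e' (Or.inl ?_) h'
      simp only [Subtype.mk.injEq, f0, he, he', h]) i hi
    obtain ⟨m, hm⟩ := hx v
    rw [hm] at this ⊢
    congr 1
    set N := ((univ.filter (x · = v)).filter (col · = i)).card
    push_cast at this
    rw [← mul_sub, abs_mul, Nat.abs_cast] at this
    have hk' : (0 : ℤ) < k := by exact_mod_cast hk
    have h3 : |(N : ℤ) - m| < 1 := by
      by_contra h
      push Not at h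
      nlinarith
    rw [Int.abs_lt_one_iff] at h3
    omega
  · exact grp_count _ k hk _ col (hgy v) h1 (by
      intro e he e' he' h h'
      simp only [Finset.mem_filter, Finset.mem_univ, true_and] at he he'
      refine h2 e e' (Or.inr ?_) h'
      simp only [Subtype.mk.injEq, g0, he, he', h]) i hi

end Konig

section Final

variable {V E : Type*} [Fintype V] [Fintype E] [DecidableEq V] [DecidableEq E]

theorem mdeg_ind (ends : E → V × V) (S : Finset E) (v : V) :
    (mdeg ends S v : ℤ) = ∑ e ∈ S, (ind {v} (ends e).1 + ind {v} (ends e).2) := by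
  unfold mdeg ind
  rw [Finset.sum_add_distrib]
  push_cast
  simp only [Finset.mem_singleton, Finset.card_filter]
  push_cast
  rfl

theorem mdeg_sum (ends : E → V × V) (S : Finset E) (A : Finset V) :
    ∑ v ∈ A, (mdeg ends S v : ℤ) = ∑ e ∈ S, (ind A (ends e).1 + ind A (ends e).2) := by
  simp only [mdeg_ind]
  rw [Finset.sum_comm]
  refine Finset.sum_congr rfl fun e _ => ?_
  rw [Finset.sum_add_distrib, ind_sum, ind_sum]

theorem mdeg_par (ends : E → V × V) (S : Finset E) (A : Finset V) :
    2 ∣ dS ends S A - ∑ v ∈ A, (-(mdeg ends S v : ℤ)) := by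
  rw [Finset.sum_neg_distrib, mdeg_sum, sub_neg_eq_add]
  unfold dS
  rw [← Finset.sum_add_distrib]
  refine Finset.dvd_sum fun e _ => ?_
  unfold cr ind
  by_cases h1 : (ends e).1 ∈ A <;> by_cases h2 : (ends e).2 ∈ A <;> simp [h1, h2]

theorem cut_dS (ends : E → V × V) (A : Finset V) : (cutCard ends A : ℤ) = dS ends univ A := by
  unfold cutCard dS cr
  rw [Finset.card_filter]
  push_cast
  refine Finset.sum_congr rfl fun e _ => ?_
  by_cases h1 : (ends e).1 ∈ A <;> by_cases h2 : (ends e).2 ∈ A <;> simp [h1, h2]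

theorem mdeg_total (ends : E → V × V) (k : ℕ) (hsize : k ∣ Fintype.card E) :
    2 * (k : ℤ) ∣ ∑ v, (-(mdeg ends univ v : ℤ)) := by
  rw [Finset.sum_neg_distrib, mdeg_sum, dvd_neg]
  simp only [ind, Finset.mem_univ, if_true]
  obtain ⟨m, hm⟩ := hsize
  simp only [Finset.sum_const, Finset.card_univ, hm]
  exact ⟨m, by simp; ring⟩

theorem sol_exists (ends : E → V × V) (k : ℕ) (hk : 2 ≤ k) (hsize : k ∣ Fintype.card E)
    (hconn : EdgeConn ends (3 * k - 3) ∨ TreeConn ends (2 * k - 2)) :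
    Sol (k : ℤ) ends univ univ (fun v => -(mdeg ends univ v : ℤ)) := by
  have hk' : (2 : ℤ) ≤ k := by exact_mod_cast hk
  rcases hconn with h | ⟨T, hd, hT⟩
  · refine thmL (o := fun _ => 0) (i := fun _ => 0) (U := ∅)
      { hk := hk', mem := by simp, onn := fun _ _ => le_rfl, inn := fun _ _ => le_rfl,
        par := fun A _ => mdeg_par ends univ A,
        sum := mdeg_total ends k hsize, root := ?_, Usub := by simp, Ucard := by simp,
        Uz := by simp, cut := ?_ }
    · rw [F_zero, dS_W (by simp)]
      have := nrm_nonneg hk' (∑ v, (-(mdeg ends univ v : ℤ)))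
      omega
    · intro A _ hne hA _
      rw [F_zero]
      have h1 := h A hne hA
      have h2 := cut_dS ends A
      have h3 := nrm_le hk' (∑ v ∈ A, (-(mdeg ends univ v : ℤ)))
      have h4 := nrm_par hk' (∑ v ∈ A, (-(mdeg ends univ v : ℤ)))
      have h5 := mdeg_par ends univ A
      omega
  · refine tree_thm (ι := Fin (2 * k - 2)) (T := T) hk' (by simp; omega)
      { mem := by simp, par := fun A _ => mdeg_par ends univ A,
        sum := mdeg_total ends k hsize, sub := by simp, disj := hd } ?_
    intro i A _ hne hA
    by_contra hno
    push Not at hno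
    obtain ⟨a, ha⟩ := hne
    obtain ⟨b, hb⟩ : ∃ b, b ∉ A := by
      by_contra h
      push Not at h
      exact hA (Finset.eq_univ_iff_forall.2 h)
    apply hb
    have := (hT i).1 a b
    clear hb
    induction this with
    | refl => exact ha
    | tail _ h ih =>
      obtain ⟨e, he, h⟩ := h
      have h0 := (cr_cases A (ends e)).resolve_right (hno e he)
      unfold cr at h0
      rcases h with h | h <;> rw [h] at h0 <;> simp only at h0 <;> split_ifs at h0 with h1 <;> tauto

theorem col_exists (ends : E → V × V) (k : ℕ) (hk : 2 ≤ k) (hsize : k ∣ Fintype.card E)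
    (hconn : EdgeConn ends (3 * k - 3) ∨ TreeConn ends (2 * k - 2)) :
    ∃ col : E → ℕ, (∀ e, col e < k) ∧
      (∀ i, i < k → k * (univ.filter (col · = i)).card = Fintype.card E) ∧
      ∀ v i, i < k → |(k : ℤ) * mdeg ends (univ.filter (col · = i)) v - mdeg ends univ v| < k := by
  obtain ⟨ε, hε, hsol⟩ := sol_exists ends k hk hsize hconn
  set x : E → V := fun e => if ε e = 1 then (ends e).1 else (ends e).2 with hx
  set y : E → V := fun e => if ε e = 1 then (ends e).2 else (ends e).1 with hy
  have hmd : ∀ S v, mdeg ends S v = (S.filter (x · = v)).card + (S.filter (y · = v)).card := by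
    intro S v
    unfold mdeg
    simp only [Finset.card_filter]
    rw [← Finset.sum_add_distrib, ← Finset.sum_add_distrib]
    refine Finset.sum_congr rfl fun e _ => ?_
    simp only [hx, hy]
    split_ifs <;> rfl
  have hdv : ∀ v, k ∣ (univ.filter (x · = v)).card := by
    intro v
    have h1 := hsol v (Finset.mem_univ v)
    have h2 : nt ends univ ε {v} - -(mdeg ends univ v : ℤ)
        = 2 * ((univ.filter (x · = v)).card : ℤ) := by
      rw [sub_neg_eq_add, mdeg_ind]
      unfold nt
      rw [← Finset.sum_add_distrib, Finset.card_filter]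
      push_cast
      rw [Finset.mul_sum]
      refine Finset.sum_congr rfl fun e _ => ?_
      have h3 : (if x e = v then (1 : ℤ) else 0) = ind {v} (x e) := by simp [ind]
      rw [h3]
      simp only [hx]
      rcases hε e with h | h
      · rw [h, if_pos rfl]; ring
      · rw [h, if_neg (by norm_num)]; ring
    rw [h2] at h1
    exact_mod_cast Int.dvd_of_mul_dvd_mul_left (by norm_num) h1
  obtain ⟨col, hc, h⟩ := equit x y k (by omega) hdv
  refine ⟨col, hc, ?_, ?_⟩
  · intro i hi
    have h1 := Finset.card_eq_sum_card_fiberwise (s := univ.filter (col · = i)) (f := x)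
      (t := univ) (by simp)
    have h2 := Finset.card_eq_sum_card_fiberwise (s := (univ : Finset E)) (f := x)
      (t := univ) (by simp)
    rw [h1, Finset.mul_sum, ← Finset.card_univ, h2]
    refine Finset.sum_congr rfl fun v _ => ?_
    rw [← (h v i hi).1, Finset.filter_comm]
  · intro v i hi
    have h1 := (h v i hi).1
    have h2 := (h v i hi).2
    rw [hmd, hmd, Finset.filter_comm, Finset.filter_comm (fun e => col e = i) (fun e => y e = v)]
    have h1 : (k : ℤ) * (((univ.filter (x · = v)).filter (col · = i)).card : ℤ) =
        ((univ.filter (x · = v)).card : ℤ) := by rw [← Nat.cast_mul, h1]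
    push_cast
    rw [mul_add, h1]
    convert h2 using 2
    ring

end Final

end EqFac

/-- Equitable factorization into `k` factors of equal size when `k` divides `|E(G)|`. -/
theorem equitable_factorization_equal_sizes [Fintype V] [Fintype E] [DecidableEq V]
    (ends : E → V × V) (k : ℕ) (hk : 0 < k)
    (hsize : k ∣ Fintype.card E)
    (hconn : EdgeConn ends (3 * k - 3) ∨ TreeConn ends (2 * k - 2)) :
    ∃ c : E → Fin k,
      (∀ i j : Fin k,
        (univ.filter fun e : E => c e = i).card = (univ.filter fun e : E => c e = j).card) ∧
      (∀ v : V, ∀ i : Fin k,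
        |((mdeg ends (univ.filter fun e => c e = i) v : ℝ)) -
          (mdeg ends univ v : ℝ) / (k : ℝ)| < 1) := by
  classical
  rcases Nat.lt_or_ge 1 k with hk2 | hk1
  · obtain ⟨col, h1, h2, h3⟩ := EqFac.col_exists ends k hk2 hsize hconn
    have hfil : ∀ i : Fin k, (univ.filter fun e : E => (⟨col e, h1 e⟩ : Fin k) = i) =
        univ.filter (fun e => col e = (i : ℕ)) := by
      intro i
      apply Finset.filter_congr
      intro e _
      exact Fin.ext_iff
    refine ⟨fun e => ⟨col e, h1 e⟩, ?_, ?_⟩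
    · intro i j
      rw [hfil, hfil]
      exact Nat.eq_of_mul_eq_mul_left hk ((h2 i i.2).trans (h2 j j.2).symm)
    · intro v i
      rw [hfil]
      have h4 := h3 v i i.2
      have hk' : (0 : ℝ) < k := by exact_mod_cast hk
      have h5 : |(k : ℝ) * mdeg ends (univ.filter (fun e => col e = (i : ℕ))) v
          - mdeg ends univ v| < k := by exact_mod_cast h4
      have h6 : ((mdeg ends (univ.filter (fun e => col e = (i : ℕ))) v : ℝ)) -
          (mdeg ends univ v : ℝ) / (k : ℝ) =
          ((k : ℝ) * mdeg ends (univ.filter (fun e => col e = (i : ℕ))) v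
          - mdeg ends univ v) / k := by
        field_simp
      rw [h6, abs_div, abs_of_pos hk', div_lt_one hk']
      exact h5
  · have hk1' : k = 1 := by omega
    subst hk1'
    refine ⟨fun _ => 0, ?_, ?_⟩
    · intro i j
      rw [Subsingleton.elim i j]
    · intro v i
      have : (univ.filter fun _ : E => (0 : Fin 1) = i) = univ := by
        apply Finset.filter_true_of_mem
        intro e _
        exact Subsingleton.elim _ _
      rw [this]
      simp
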